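/- Assume (h1), (h2), (f1)–(f4). Then there exists a function u : ℤ^d → ℝ with u(x) > 0 for every x ∈ ℤ^d and ‖u‖_{H_{s,p}} < ∞ which solves (−Δ)_p^s u(x) + h(x)·u(x)^{p−1} = (R_α∗F(u))(x)·f(u(x)) pointwise on ℤ^d (all series converging absolutely), and which is a ground state: J̃(u) = inf{ J̃(v) : v ∈ M }, where M is the Nehari set. -/

import Mathlib

open MeasureTheory Filter Topology
open scoped ENNReal

noncomputable section

namespace DiscreteChoquard

variable {d : ℕ}

/-- The lattice `ℤ^d`. -/
abbrev Z (d : ℕ) := Fin d → ℤ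

/-- Graph distance on `ℤ^d`, as a real number. -/
def latDist (x y : Z d) : ℝ := ∑ i, |((x i - y i : ℤ) : ℝ)|

/-- The kernel hypotheses on `W_s`: symmetry, positivity, and the two-sided bound
`c|x−y|^{−d−2s} ≤ W_s(x,y) ≤ C|x−y|^{−d−2s}` for `x ≠ y`. -/
def KernelOK (d : ℕ) (s : ℝ) (W : Z d → Z d → ℝ) : Prop :=
  (∀ x y, W x y = W y x) ∧ (∀ x y, 0 < W x y) ∧
  ∃ c C : ℝ, 0 < c ∧ c ≤ C ∧ ∀ x y : Z d, x ≠ y →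
    c * latDist x y ^ (-(d : ℝ) - 2 * s) ≤ W x y ∧
      W x y ≤ C * latDist x y ^ (-(d : ℝ) - 2 * s)

/-- The fractional gradient form `∇^s u ∇^s v (x)`.  (The `y = x` summand vanishes, so we
sum over all `y`.) -/
def gradForm (W : Z d → Z d → ℝ) (u v : Z d → ℝ) (x : Z d) : ℝ :=
  (1 / 2) * ∑' y : Z d, W x y * (u x - u y) * (v x - v y)

/-- `|∇^s u|(x)`. -/
def gradNorm (W : Z d → Z d → ℝ) (u : Z d → ℝ) (x : Z d) : ℝ :=
  Real.sqrt ((1 / 2) * ∑' y : Z d, W x y * (u x - u y) ^ 2)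

/-- The fractional `p`-Laplacian `(−Δ)_p^s u (x)`. -/
def pLap (W : Z d → Z d → ℝ) (p : ℝ) (u : Z d → ℝ) (x : Z d) : ℝ :=
  (1 / 2) * ∑' y : Z d,
    W x y * (gradNorm W u x ^ (p - 2) + gradNorm W u y ^ (p - 2)) * (u x - u y)

/-- `‖u‖_{H_{s,p}}^p = ∑_x (|∇^s u|^p(x) + h(x)|u(x)|^p)`. -/
def HnormP (W : Z d → Z d → ℝ) (h : Z d → ℝ) (p : ℝ) (u : Z d → ℝ) : ℝ :=
  ∑' x : Z d, (gradNorm W u x ^ p + h x * |u x| ^ p)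

/-- `‖u‖_{H_{s,p}}`. -/
def normH (W : Z d → Z d → ℝ) (h : Z d → ℝ) (p : ℝ) (u : Z d → ℝ) : ℝ :=
  HnormP W h p u ^ (1 / p)

/-- Membership `u ∈ H_{s,p}`, i.e. `‖u‖_{H_{s,p}} < ∞` (all the defining series converge). -/
def memH (W : Z d → Z d → ℝ) (h : Z d → ℝ) (p : ℝ) (u : Z d → ℝ) : Prop :=
  (∀ x : Z d, Summable fun y : Z d => W x y * (u x - u y) ^ 2) ∧
  Summable fun x : Z d => gradNorm W u x ^ p + h x * |u x| ^ p

/-- The `ℓ^q` norm on `ℤ^d`. -/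
def lnorm (q : ℝ) (u : Z d → ℝ) : ℝ := (∑' x : Z d, |u x| ^ q) ^ (1 / q)

/-- The torus box `[0, 2π]^d`. -/
def box (d : ℕ) : Set (Fin d → ℝ) := Set.univ.pi fun _ => Set.Icc 0 (2 * Real.pi)

/-- `μ(k) = 2d − 2 ∑_j cos k_j`. -/
def muk (d : ℕ) (k : Fin d → ℝ) : ℝ := 2 * d - 2 * ∑ j, Real.cos (k j)

/-- The fractional degree `K_α = (2π)^{-d} ∫_{[0,2π]^d} μ(k)^{α/2} dk`. -/
def Kfrac (d : ℕ) (α : ℝ) : ℝ :=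
  (2 * Real.pi) ^ (-(d : ℝ)) * ∫ k in box d, muk d k ^ (α / 2)

/-- The Green's function `R_α(x,y)` of the discrete fractional Laplacian. -/
def Riesz (d : ℕ) (α : ℝ) (x y : Z d) : ℝ :=
  Kfrac d α * (2 * Real.pi) ^ (-(d : ℝ)) *
    ∫ k in box d, Real.cos (∑ j, ((x j - y j : ℤ) : ℝ) * k j) * muk d k ^ (-(α / 2))

/-- The convolution `(R_α ∗ v)(x) = ∑_y R_α(x,y) v(y)`. -/
def conv (d : ℕ) (α : ℝ) (v : Z d → ℝ) (x : Z d) : ℝ := ∑' y : Z d, Riesz d α x y * v y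

/-- `F(t) = ∫_0^t f(r) dr`. -/
def Fint (f : ℝ → ℝ) (t : ℝ) : ℝ := ∫ r in (0 : ℝ)..t, f r

/-- Positive part `u⁺ = max(u,0)`. -/
def pos (u : Z d → ℝ) (x : Z d) : ℝ := max (u x) 0

/-- Negative part `u⁻ = min(u,0)`. -/
def negp (u : Z d → ℝ) (x : Z d) : ℝ := min (u x) 0

/-- Hypothesis (h2): `h(x) → ∞` as `|x| → ∞`. -/
def H2 (h : Z d → ℝ) : Prop := Tendsto h cofinite atTop

/-- Hypothesis (f1): `f(t) = o(t^{p−1})` as `t → 0⁺`. -/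
def F1 (f : ℝ → ℝ) (p : ℝ) : Prop :=
  ∀ ε > (0 : ℝ), ∃ δ > (0 : ℝ), ∀ t : ℝ, 0 < t → t < δ → |f t| ≤ ε * t ^ (p - 1)

/-- Hypothesis (f3): `0 ≤ θ F(t) ≤ 2 f(t) t` for `t > 0`. -/
def F3 (f : ℝ → ℝ) (θ : ℝ) : Prop :=
  ∀ t > (0 : ℝ), 0 ≤ θ * Fint f t ∧ θ * Fint f t ≤ 2 * f t * t

/-- The energy functional `J̃`. -/
def energy (W : Z d → Z d → ℝ) (h : Z d → ℝ) (p α : ℝ) (f : ℝ → ℝ) (u : Z d → ℝ) : ℝ :=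
  (1 / p) * HnormP W h p u -
    (1 / 2) * ∑' x : Z d, conv d α (fun y => Fint f (pos u y)) x * Fint f (pos u x)

/-- The Nehari set `M`. -/
def Nehari (W : Z d → Z d → ℝ) (h : Z d → ℝ) (p α : ℝ) (f : ℝ → ℝ) : Set (Z d → ℝ) :=
  {u | memH W h p u ∧ u ≠ 0 ∧
    HnormP W h p u =
      ∑' x : Z d, conv d α (fun y => Fint f (pos u y)) x * f (pos u x) * pos u x}

/-- Hypothesis (f4). -/
def F4 (W : Z d → Z d → ℝ) (h : Z d → ℝ) (p α : ℝ) (f : ℝ → ℝ) : Prop :=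
  ∀ u : Z d → ℝ, memH W h p u → pos u ≠ 0 →
    StrictMonoOn (fun t : ℝ =>
      t ^ (1 - p) *
        ∑' x : Z d, conv d α (fun y => Fint f (t * pos u y)) x * f (t * pos u x) * pos u x)
      (Set.Ioi 0)

/-- The derivative pairing `⟨J̃′(u), φ⟩`. -/
def pairing (W : Z d → Z d → ℝ) (h : Z d → ℝ) (p α : ℝ) (f : ℝ → ℝ) (u φ : Z d → ℝ) : ℝ :=
  (∑' x : Z d,
      (gradNorm W u x ^ (p - 2) * gradForm W u φ x + h x * |u x| ^ (p - 2) * u x * φ x)) -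
    ∑' x : Z d, conv d α (fun y => Fint f (pos u y)) x * f (pos u x) * φ x

/-- `F(t⁺)`. -/
def Phi (f : ℝ → ℝ) (t : ℝ) : ℝ := Fint f (max t 0)

/-- `f(t⁺) t⁺`. -/
def Psi (f : ℝ → ℝ) (t : ℝ) : ℝ := f (max t 0) * max t 0

/-- Standing assumptions on the nonlinearity. -/
structure FOK (f : ℝ → ℝ) (p θ : ℝ) : Prop where
  cont : Continuous f
  zero : ∀ t ≤ (0 : ℝ), f t = 0
  f1 : F1 f p
  f3 : F3 f θ
  two_le : 2 ≤ p
  lt : p < θ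

namespace FOK

variable {f : ℝ → ℝ} {p θ : ℝ}

lemma p_pos (H : FOK f p θ) : 0 < p := by linarith [H.two_le]

lemma F_nonneg (H : FOK f p θ) {t : ℝ} (ht : 0 ≤ t) : 0 ≤ Fint f t := by
  rcases ht.eq_or_lt with rfl | ht
  · simp [Fint]
  · have := (H.f3 t ht).1
    have h1 : 0 < θ := by linarith [H.two_le, H.lt]
    by_contra hc
    push Not at hc
    nlinarith

lemma f_nonneg (H : FOK f p θ) (t : ℝ) : 0 ≤ f t := by
  rcases le_or_gt t 0 with ht | ht
  · rw [H.zero t ht]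
  · have := (H.f3 t ht)
    by_contra hc
    push Not at hc
    nlinarith [this.1, this.2]

lemma hasDerivAt (H : FOK f p θ) (t : ℝ) : HasDerivAt (Fint f) (f t) t :=
  intervalIntegral.integral_hasDerivAt_right (H.cont.intervalIntegrable _ _)
    (H.cont.stronglyMeasurableAtFilter _ _) H.cont.continuousAt

lemma F_cont (H : FOK f p θ) : Continuous (Fint f) :=
  continuous_iff_continuousAt.2 fun t => (H.hasDerivAt t).continuousAt

lemma F_mono (H : FOK f p θ) : Monotone (Fint f) :=
  monotone_of_deriv_nonneg (fun t => (H.hasDerivAt t).differentiableAt)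
    (fun t => by rw [(H.hasDerivAt t).deriv]; exact H.f_nonneg t)

lemma F_zero : Fint f 0 = 0 := by simp [Fint]

lemma Phi_cont (H : FOK f p θ) : Continuous (Phi f) :=
  H.F_cont.comp (continuous_id.max continuous_const)

lemma Psi_cont (H : FOK f p θ) : Continuous (Psi f) :=
  (H.cont.comp (continuous_id.max continuous_const)).mul (continuous_id.max continuous_const)

lemma Phi_nonneg (H : FOK f p θ) (t : ℝ) : 0 ≤ Phi f t := H.F_nonneg (le_max_right _ _)

lemma Psi_nonneg (H : FOK f p θ) (t : ℝ) : 0 ≤ Psi f t :=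
  mul_nonneg (H.f_nonneg _) (le_max_right _ _)

lemma ar (H : FOK f p θ) (t : ℝ) : θ * Phi f t ≤ 2 * Psi f t := by
  unfold Phi Psi
  rcases le_or_gt t 0 with ht | ht
  · simp [max_eq_right ht, F_zero]
  · rw [max_eq_left ht.le]
    have := (H.f3 t ht).2
    linarith

lemma f_loc (H : FOK f p θ) (m : ℝ) :
    ∃ C : ℝ, 0 ≤ C ∧ ∀ t, 0 ≤ t → t ≤ m → |f t| ≤ C * t ^ (p - 1) := by
  obtain ⟨δ, hδ, hδ'⟩ := H.f1 1 one_pos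
  obtain ⟨K, hK⟩ := (isCompact_Icc (a := (0:ℝ)) (b := m)).exists_bound_of_continuousOn
    H.cont.continuousOn
  have hp1 : 0 < p - 1 := by linarith [H.two_le]
  have hδp : 0 < δ ^ (p - 1) := Real.rpow_pos_of_pos hδ _
  refine ⟨1 + |K| / δ ^ (p - 1), by positivity, fun t ht htm => ?_⟩
  rcases ht.eq_or_lt with rfl | ht0
  · rw [H.zero 0 le_rfl]; simp [Real.zero_rpow hp1.ne']
  have htp : 0 < t ^ (p - 1) := Real.rpow_pos_of_pos ht0 _
  rcases lt_or_ge t δ with h1 | h1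
  · refine (hδ' t ht0 h1).trans ?_
    have : 0 ≤ |K| / δ ^ (p - 1) := by positivity
    nlinarith
  · have h2 : |f t| ≤ |K| := by
      have := hK t ⟨ht, htm⟩
      rw [Real.norm_eq_abs] at this
      exact this.trans (le_abs_self _)
    have h3 : δ ^ (p - 1) ≤ t ^ (p - 1) := Real.rpow_le_rpow hδ.le h1 hp1.le
    have h4 : |K| ≤ |K| / δ ^ (p - 1) * t ^ (p - 1) := by
      rw [div_mul_eq_mul_div, le_div_iff₀ hδp]
      exact mul_le_mul_of_nonneg_left h3 (abs_nonneg _)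
    nlinarith

lemma rpow_sub_one_mul (H : FOK f p θ) {t : ℝ} (ht : 0 ≤ t) : t ^ (p - 1) * t = t ^ p := by
  rcases ht.eq_or_lt with rfl | ht0
  · rw [Real.zero_rpow H.p_pos.ne']; simp
  · rw [← Real.rpow_add_one ht0.ne']; congr 1; ring

lemma loc (H : FOK f p θ) (m : ℝ) :
    ∃ C : ℝ, 0 ≤ C ∧ (∀ t, 0 ≤ t → t ≤ m → |f t| ≤ C * t ^ (p - 1)) ∧
      (∀ t, |t| ≤ m → |Phi f t| ≤ C * |t| ^ p) ∧ (∀ t, |t| ≤ m → |Psi f t| ≤ C * |t| ^ p) := by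
  obtain ⟨C, hC, hb⟩ := H.f_loc m
  have hp1 : 0 < p - 1 := by linarith [H.two_le]
  have hpp := H.p_pos
  have key : ∀ t, |t| ≤ m → 0 ≤ max t 0 ∧ max t 0 ≤ m ∧ max t 0 ≤ |t| := by
    intro t ht
    refine ⟨le_max_right _ _, (max_le (le_abs_self t) (abs_nonneg t)).trans ht,
      max_le (le_abs_self t) (abs_nonneg t)⟩
  refine ⟨C, hC, hb, fun t ht => ?_, fun t ht => ?_⟩
  · obtain ⟨h0, h1, h2⟩ := key t ht
    set r := max t 0 with hr
    have : ‖Fint f r‖ ≤ C * r ^ (p - 1) * |r - 0| := by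
      apply intervalIntegral.norm_integral_le_of_norm_le_const
      intro x hx
      rw [Set.uIoc_of_le h0] at hx
      rw [Real.norm_eq_abs]
      refine (hb x hx.1.le (hx.2.trans h1)).trans ?_
      exact mul_le_mul_of_nonneg_left (Real.rpow_le_rpow hx.1.le hx.2 hp1.le) hC
    rw [Real.norm_eq_abs, sub_zero, abs_of_nonneg h0, mul_assoc, H.rpow_sub_one_mul h0] at this
    exact this.trans (mul_le_mul_of_nonneg_left (Real.rpow_le_rpow h0 h2 hpp.le) hC)
  · obtain ⟨h0, h1, h2⟩ := key t ht
    unfold Psi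
    set r := max t 0 with hr
    rw [abs_mul, abs_of_nonneg h0]
    calc |f r| * r ≤ C * r ^ (p - 1) * r := mul_le_mul_of_nonneg_right (hb r h0 h1) h0
      _ = C * r ^ p := by rw [mul_assoc, H.rpow_sub_one_mul h0]
      _ ≤ _ := mul_le_mul_of_nonneg_left (Real.rpow_le_rpow h0 h2 hpp.le) hC

lemma growth (H : FOK f p θ) {t : ℝ} (ht : 1 ≤ t) : Fint f 1 * t ^ (θ / 2) ≤ Fint f t := by
  have hm : MonotoneOn (fun t : ℝ => Fint f t * t ^ (-(θ / 2))) (Set.Ici 1) := by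
    apply monotoneOn_of_deriv_nonneg (convex_Ici 1)
    · apply ContinuousOn.mul H.F_cont.continuousOn
      intro x hx
      exact (Real.continuousAt_rpow_const x _ (Or.inl (by
        have : (1:ℝ) ≤ x := hx
        linarith))).continuousWithinAt
    · intro x hx
      rw [interior_Ici] at hx
      have hx : (1:ℝ) < x := hx
      exact ((H.hasDerivAt x).differentiableAt.mul
        (Real.hasDerivAt_rpow_const (Or.inl (by linarith))).differentiableAt).differentiableWithinAt
    · intro x hx
      rw [interior_Ici] at hx
      have hx : (1:ℝ) < x := hx
      have hx0 : 0 < x := by linarith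
      have hd := (H.hasDerivAt x).mul
        (Real.hasDerivAt_rpow_const (x := x) (p := -(θ / 2)) (Or.inl (by linarith)))
      have : deriv (fun t : ℝ => Fint f t * t ^ (-(θ / 2))) x = _ := hd.deriv
      rw [this]
      have h1 : x ^ (-(θ / 2)) = x * x ^ (-(θ / 2) - 1) := by
        rw [mul_comm, ← Real.rpow_add_one hx0.ne']; congr 1; ring
      rw [h1]
      have h2 : 0 < x ^ (-(θ / 2) - 1) := Real.rpow_pos_of_pos hx0 _
      have h3 := (H.f3 x hx0).2
      have : f x * (x * x ^ (-(θ / 2) - 1)) + Fint f x * (-(θ / 2) * x ^ (-(θ / 2) - 1)) =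
        (1 / 2) * (2 * f x * x - θ * Fint f x) * x ^ (-(θ / 2) - 1) := by ring
      rw [this]
      apply mul_nonneg _ h2.le
      linarith
  have := hm (Set.mem_Ici.2 le_rfl) (Set.mem_Ici.2 ht) ht
  simp only [Real.one_rpow, mul_one] at this
  have ht0 : 0 < t := by linarith
  have h2 : 0 < t ^ (θ / 2) := Real.rpow_pos_of_pos ht0 _
  calc Fint f 1 * t ^ (θ / 2) ≤ Fint f t * t ^ (-(θ / 2)) * t ^ (θ / 2) :=
        mul_le_mul_of_nonneg_right this h2.le
    _ = Fint f t := by rw [mul_assoc, ← Real.rpow_add ht0]; simp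

end FOK

/-- Standing assumptions on the convolution kernel. -/
structure ROK (R : Z d → Z d → ℝ) (R0 : ℝ) : Prop where
  symm : ∀ x y, R x y = R y x
  nonneg : ∀ x y, 0 ≤ R x y
  le : ∀ x y, R x y ≤ R0

/-- Convolution with a general kernel. -/
def cv (R : Z d → Z d → ℝ) (a : Z d → ℝ) (x : Z d) : ℝ := ∑' y, R x y * a y

/-- The bilinear form of a kernel. -/
def bil (R : Z d → Z d → ℝ) (a c : Z d → ℝ) : ℝ := ∑' x, cv R a x * c x

namespace ROK

variable {R : Z d → Z d → ℝ} {R0 : ℝ} {a b c : Z d → ℝ}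

lemma R0_nonneg (H : ROK R R0) : 0 ≤ R0 := (H.nonneg 0 0).trans (H.le 0 0)

lemma summable_cv (H : ROK R R0) (ha : Summable fun x => |a x|) (x : Z d) :
    Summable fun y => R x y * a y := by
  refine Summable.of_norm_bounded (ha.mul_left R0) fun y => ?_
  rw [Real.norm_eq_abs, abs_mul, abs_of_nonneg (H.nonneg x y)]
  exact mul_le_mul_of_nonneg_right (H.le x y) (abs_nonneg _)

lemma abs_cv_le (H : ROK R R0) (ha : Summable fun x => |a x|) (x : Z d) :
    |cv R a x| ≤ R0 * ∑' y, |a y| := by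
  rw [← tsum_mul_left, ← Real.norm_eq_abs]
  refine tsum_of_norm_bounded (ha.mul_left R0).hasSum fun y => ?_
  rw [Real.norm_eq_abs, abs_mul, abs_of_nonneg (H.nonneg x y)]
  exact mul_le_mul_of_nonneg_right (H.le x y) (abs_nonneg _)

lemma summable_bil (H : ROK R R0) (ha : Summable fun x => |a x|) (hc : Summable fun x => |c x|) :
    Summable fun x => cv R a x * c x := by
  refine Summable.of_norm_bounded (hc.mul_left (R0 * ∑' y, |a y|)) fun y => ?_
  rw [Real.norm_eq_abs, abs_mul]
  exact mul_le_mul_of_nonneg_right (H.abs_cv_le ha y) (abs_nonneg _)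

lemma abs_bil_le (H : ROK R R0) (ha : Summable fun x => |a x|) (hc : Summable fun x => |c x|) :
    |bil R a c| ≤ R0 * (∑' y, |a y|) * ∑' y, |c y| := by
  rw [← tsum_mul_left, ← Real.norm_eq_abs]
  refine tsum_of_norm_bounded (hc.mul_left (R0 * ∑' y, |a y|)).hasSum fun y => ?_
  rw [Real.norm_eq_abs, abs_mul]
  exact mul_le_mul_of_nonneg_right (H.abs_cv_le ha y) (abs_nonneg _)

lemma cv_sub (H : ROK R R0) (ha : Summable fun x => |a x|) (hb : Summable fun x => |b x|)
    (x : Z d) : cv R (fun y => a y - b y) x = cv R a x - cv R b x := by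
  unfold cv
  rw [← (H.summable_cv ha x).tsum_sub (H.summable_cv hb x)]
  exact tsum_congr fun y => by ring

lemma cv_nonneg (H : ROK R R0) (ha : ∀ x, 0 ≤ a x) (x : Z d) : 0 ≤ cv R a x :=
  tsum_nonneg fun y => mul_nonneg (H.nonneg x y) (ha y)

lemma summable_abs_sub (ha : Summable fun x => |a x|) (hb : Summable fun x => |b x|) :
    Summable fun x => |a x - b x| :=
  Summable.of_nonneg_of_le (fun _ => abs_nonneg _) (fun x => abs_sub (a x) (b x)) (ha.add hb)

lemma summable_abs_add (ha : Summable fun x => |a x|) (hb : Summable fun x => |b x|) :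
    Summable fun x => |a x + b x| :=
  Summable.of_nonneg_of_le (fun _ => abs_nonneg _) (fun x => abs_add_le (a x) (b x)) (ha.add hb)

lemma bil_sub_left (H : ROK R R0) (ha : Summable fun x => |a x|) (hb : Summable fun x => |b x|)
    (hc : Summable fun x => |c x|) :
    bil R (fun y => a y - b y) c = bil R a c - bil R b c := by
  unfold bil
  rw [← (H.summable_bil ha hc).tsum_sub (H.summable_bil hb hc)]
  exact tsum_congr fun y => by rw [H.cv_sub ha hb]; ring

lemma bil_sub_right (H : ROK R R0) (ha : Summable fun x => |a x|) (hb : Summable fun x => |b x|)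
    (hc : Summable fun x => |c x|) :
    bil R a (fun y => b y - c y) = bil R a b - bil R a c := by
  unfold bil
  rw [← (H.summable_bil ha hb).tsum_sub (H.summable_bil ha hc)]
  exact tsum_congr fun y => by ring

lemma bil_symm (H : ROK R R0) (ha : Summable fun x => |a x|) (hc : Summable fun x => |c x|) :
    bil R a c = bil R c a := by
  have hs : Summable (Function.uncurry fun (x y : Z d) => R x y * a y * c x) := by
    refine Summable.of_norm_bounded (g := fun q : Z d × Z d => R0 * (|c q.1| * |a q.2|))
      ((hc.mul_of_nonneg ha (fun _ => abs_nonneg _) (fun _ => abs_nonneg _)).mul_left R0) ?_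
    rintro ⟨x, y⟩
    simp only [Function.uncurry, Real.norm_eq_abs, abs_mul, abs_of_nonneg (H.nonneg x y)]
    have := mul_le_mul_of_nonneg_right (H.le x y) (mul_nonneg (abs_nonneg (c x)) (abs_nonneg (a y)))
    linarith
  have h1 : bil R a c = ∑' x, ∑' y, R x y * a y * c x := by
    unfold bil cv
    exact tsum_congr fun x => by rw [tsum_mul_right]
  have h2 : bil R c a = ∑' y, ∑' x, R x y * a y * c x := by
    unfold bil cv
    refine tsum_congr fun y => ?_
    rw [← tsum_mul_right]
    exact tsum_congr fun x => by rw [H.symm y x]; ring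
  rw [h1, h2]
  exact hs.tsum_comm.symm

/-- `ℓ¹` convergence, as used below. -/
def L1 {ι : Type*} (l : Filter ι) (an : ι → Z d → ℝ) (a : Z d → ℝ) : Prop :=
  (∀ᶠ n in l, Summable fun x => |an n x|) ∧ (Summable fun x => |a x|) ∧
    Tendsto (fun n => ∑' x, |an n x - a x|) l (𝓝 0)

lemma L1.tendsto_tsum_abs {ι : Type*} {l : Filter ι} {an : ι → Z d → ℝ} {a : Z d → ℝ}
    (h : L1 l an a) : Tendsto (fun n => ∑' x, |an n x|) l (𝓝 (∑' x, |a x|)) := by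
  rw [tendsto_iff_norm_sub_tendsto_zero]
  refine tendsto_of_tendsto_of_tendsto_of_le_of_le' tendsto_const_nhds h.2.2
    (Eventually.of_forall fun n => norm_nonneg _) ?_
  filter_upwards [h.1] with n hn
  rw [← hn.tsum_sub h.2.1]
  refine tsum_of_norm_bounded (summable_abs_sub hn h.2.1).hasSum fun x => ?_
  rw [Real.norm_eq_abs]
  exact abs_abs_sub_abs_le_abs_sub _ _

lemma tendsto_cv (H : ROK R R0) {ι : Type*} {l : Filter ι} {an : ι → Z d → ℝ} {a : Z d → ℝ}
    (ha : L1 l an a) (x : Z d) : Tendsto (fun n => cv R (an n) x) l (𝓝 (cv R a x)) := by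
  rw [tendsto_iff_norm_sub_tendsto_zero]
  refine tendsto_of_tendsto_of_tendsto_of_le_of_le' tendsto_const_nhds
    (by simpa using ha.2.2.const_mul R0) (Eventually.of_forall fun n => norm_nonneg _) ?_
  filter_upwards [ha.1] with n hn
  rw [← H.cv_sub hn ha.2.1, Real.norm_eq_abs]
  exact H.abs_cv_le (summable_abs_sub hn ha.2.1) x

lemma tendsto_bil (H : ROK R R0) {ι : Type*} {l : Filter ι} {an cn : ι → Z d → ℝ}
    {a c : Z d → ℝ} (ha : L1 l an a) (hc : L1 l cn c) :
    Tendsto (fun n => bil R (an n) (cn n)) l (𝓝 (bil R a c)) := by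
  rw [tendsto_iff_norm_sub_tendsto_zero]
  have hlim : Tendsto (fun n => R0 * (∑' x, |an n x - a x|) * (∑' x, |cn n x|) +
      R0 * (∑' x, |a x|) * ∑' x, |cn n x - c x|) l (𝓝 0) := by
    have := ((ha.2.2.const_mul R0).mul hc.tendsto_tsum_abs).add
      (hc.2.2.const_mul (R0 * ∑' x, |a x|))
    simpa using this
  refine tendsto_of_tendsto_of_tendsto_of_le_of_le' tendsto_const_nhds hlim
    (Eventually.of_forall fun n => norm_nonneg _) ?_
  filter_upwards [ha.1, hc.1] with n hn hm
  have e : bil R (an n) (cn n) - bil R a c =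
      bil R (fun x => an n x - a x) (cn n) + bil R a (fun x => cn n x - c x) := by
    rw [H.bil_sub_left hn ha.2.1 hm, H.bil_sub_right ha.2.1 hm hc.2.1]; ring
  rw [e, Real.norm_eq_abs]
  refine (abs_add_le _ _).trans (add_le_add ?_ ?_)
  · exact H.abs_bil_le (summable_abs_sub hn ha.2.1) hm
  · exact H.abs_bil_le ha.2.1 (summable_abs_sub hm hc.2.1)

end ROK

/-- Standing assumptions on the potential. -/
structure HOK (h : Z d → ℝ) (h₀ p : ℝ) : Prop where
  pos : 0 < h₀
  le : ∀ x, h₀ ≤ h x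
  tends : Tendsto h cofinite atTop
  p_pos : 0 < p

namespace HOK

variable {h : Z d → ℝ} {h₀ p : ℝ}

lemma h_pos (H : HOK h h₀ p) (x : Z d) : 0 < h x := H.pos.trans_le (H.le x)

lemma term_nonneg (H : HOK h h₀ p) (u : Z d → ℝ) (x : Z d) : 0 ≤ h x * |u x| ^ p :=
  mul_nonneg (H.h_pos x).le (Real.rpow_nonneg (abs_nonneg _) _)

lemma abs_le (H : HOK h h₀ p) {u : Z d → ℝ} (hu : Summable fun x => h x * |u x| ^ p) {K : ℝ}
    (hK : ∑' x, h x * |u x| ^ p ≤ K) (x : Z d) : |u x| ≤ (K / h₀) ^ (1 / p) := by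
  have h1 : h₀ * |u x| ^ p ≤ K :=
    (mul_le_mul_of_nonneg_right (H.le x) (Real.rpow_nonneg (abs_nonneg _) _)).trans
      ((hu.le_tsum x fun y _ => H.term_nonneg u y).trans hK)
  have h2 : |u x| ^ p ≤ K / h₀ := by rw [le_div_iff₀ H.pos]; linarith
  calc |u x| = (|u x| ^ p) ^ (1 / p) := by
        rw [← Real.rpow_mul (abs_nonneg _), mul_one_div_cancel H.p_pos.ne', Real.rpow_one]
    _ ≤ _ := Real.rpow_le_rpow (Real.rpow_nonneg (abs_nonneg _) _) h2 (by
        have := H.p_pos; positivity)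

/-- `|u|^p` is summable. -/
lemma summable_rpow (H : HOK h h₀ p) {u : Z d → ℝ} (hu : Summable fun x => h x * |u x| ^ p) :
    Summable fun x => |u x| ^ p := by
  refine Summable.of_nonneg_of_le (fun x => Real.rpow_nonneg (abs_nonneg _) _) (fun x => ?_)
    (hu.mul_left (1 / h₀))
  have := mul_le_mul_of_nonneg_right (H.le x) (Real.rpow_nonneg (abs_nonneg (u x)) p)
  rw [div_mul_eq_mul_div, le_div_iff₀ H.pos]
  linarith

lemma tsum_rpow_le (H : HOK h h₀ p) {u : Z d → ℝ} (hu : Summable fun x => h x * |u x| ^ p) :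
    ∑' x, |u x| ^ p ≤ (1 / h₀) * ∑' x, h x * |u x| ^ p := by
  rw [← tsum_mul_left]
  refine (H.summable_rpow hu).tsum_le_tsum (fun x => ?_) (hu.mul_left (1 / h₀))
  have := mul_le_mul_of_nonneg_right (H.le x) (Real.rpow_nonneg (abs_nonneg (u x)) p)
  rw [div_mul_eq_mul_div, le_div_iff₀ H.pos]
  linarith

/-- Functions with local `p`-growth. -/
def LocP (g : ℝ → ℝ) (p : ℝ) : Prop :=
  ∀ m : ℝ, ∃ C : ℝ, 0 ≤ C ∧ ∀ t, |t| ≤ m → |g t| ≤ C * |t| ^ p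

lemma summable_comp (H : HOK h h₀ p) {g : ℝ → ℝ} (hg : LocP g p) {u : Z d → ℝ}
    (hu : Summable fun x => h x * |u x| ^ p) : Summable fun x => |g (u x)| := by
  obtain ⟨C, hC, hb⟩ := hg (((∑' x, h x * |u x| ^ p) / h₀) ^ (1 / p))
  exact Summable.of_nonneg_of_le (fun x => abs_nonneg _)
    (fun x => hb _ (H.abs_le hu le_rfl x)) ((H.summable_rpow hu).mul_left C)

lemma L1_comp (H : HOK h h₀ p) {g : ℝ → ℝ} (hgc : Continuous g) (hg : LocP g p)
    {ι : Type*} {l : Filter ι} {v : ι → Z d → ℝ} {w : Z d → ℝ}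
    (hw : Summable fun x => h x * |w x| ^ p)
    (hv : ∀ᶠ n in l, Summable fun x => h x * |v n x| ^ p) {K : ℝ}
    (hK : ∀ᶠ n in l, ∑' x, h x * |v n x| ^ p ≤ K)
    (hlim : ∀ x, Tendsto (fun n => v n x) l (𝓝 (w x))) :
    ROK.L1 l (fun n x => g (v n x)) (fun x => g (w x)) := by
  refine ⟨hv.mono fun n hn => H.summable_comp hg hn, H.summable_comp hg hw, ?_⟩
  set K' := max K (∑' x, h x * |w x| ^ p) with hK'
  have hK'0 : 0 ≤ K' := le_max_of_le_right (tsum_nonneg fun x => H.term_nonneg w x)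
  obtain ⟨C, hC, hb⟩ := hg ((K' / h₀) ^ (1 / p))
  rw [Metric.tendsto_nhds]
  intro ε hε
  -- choose the level of the potential
  set L : ℝ := 1 + 4 * C * K' / ε with hL
  have hLpos : 0 < L := by positivity
  have hfin : {x | ¬ L ≤ h x}.Finite := by
    have := H.tends.eventually (eventually_ge_atTop L)
    exact this
  set S := hfin.toFinset with hS
  have hS' : ∀ x, x ∉ S → L ≤ h x := by
    intro x hx
    by_contra hc
    exact hx (by simpa [hS] using hc)
  have hfs : Tendsto (fun n => ∑ x ∈ S, |g (v n x) - g (w x)|) l (𝓝 0) := by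
    have : Tendsto (fun n => ∑ x ∈ S, |g (v n x) - g (w x)|) l
        (𝓝 (∑ x ∈ S, |g (w x) - g (w x)|)) := by
      refine tendsto_finsetSum _ fun x _ => ?_
      exact (((hgc.tendsto _).comp (hlim x)).sub tendsto_const_nhds).abs
    simpa using this
  have hfs' := (Metric.tendsto_nhds.1 hfs) (ε / 2) (by positivity)
  filter_upwards [hfs', hv, hK] with n hn hvn hKn
  have hnn : 0 ≤ ∑' x, |g (v n x) - g (w x)| := tsum_nonneg fun x => abs_nonneg _
  rw [Real.dist_eq, sub_zero, abs_of_nonneg hnn]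
  rw [Real.dist_eq, sub_zero, abs_of_nonneg (Finset.sum_nonneg fun x _ => abs_nonneg _)] at hn
  have hs1 : Summable fun x => |g (v n x) - g (w x)| :=
    ROK.summable_abs_sub (H.summable_comp hg hvn) (H.summable_comp hg hw)
  have hbound : ∀ x, |g (v n x) - g (w x)| ≤
      (if x ∈ S then |g (v n x) - g (w x)| else 0) +
        C / L * (h x * |v n x| ^ p + h x * |w x| ^ p) := by
    intro x
    have hnn2 : 0 ≤ C / L * (h x * |v n x| ^ p + h x * |w x| ^ p) :=
      mul_nonneg (by positivity) (add_nonneg (H.term_nonneg _ x) (H.term_nonneg _ x))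
    by_cases hx : x ∈ S
    · rw [if_pos hx]; linarith
    · rw [if_neg hx, zero_add]
      have a1 := hb _ (H.abs_le hvn (hKn.trans (le_max_left _ _)) x)
      have a2 := hb _ (H.abs_le hw (le_max_right K _) x)
      have a3 : ∀ r : ℝ, 0 ≤ r → r ≤ (h x * r) / L := by
        intro r hr
        rw [le_div_iff₀ hLpos]
        have := mul_le_mul_of_nonneg_right (hS' x hx) hr
        linarith
      have a4 := mul_le_mul_of_nonneg_left
        (a3 (|v n x| ^ p) (Real.rpow_nonneg (abs_nonneg _) _)) hC
      have a5 := mul_le_mul_of_nonneg_left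
        (a3 (|w x| ^ p) (Real.rpow_nonneg (abs_nonneg _) _)) hC
      calc |g (v n x) - g (w x)| ≤ |g (v n x)| + |g (w x)| := abs_sub _ _
        _ ≤ C * (h x * |v n x| ^ p / L) + C * (h x * |w x| ^ p / L) :=
            add_le_add (a1.trans a4) (a2.trans a5)
        _ = _ := by ring
  have hsS : HasSum (fun x => if x ∈ S then |g (v n x) - g (w x)| else 0)
      (∑ x ∈ S, |g (v n x) - g (w x)|) := by
    have := hasSum_sum_of_ne_finset_zero (s := S) (L := .unconditional _)
      (f := fun x => if x ∈ S then |g (v n x) - g (w x)| else 0) (fun x hx => if_neg hx)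
    convert this using 1
    exact Finset.sum_congr rfl fun x hx => by rw [if_pos hx]
  have hs2 := hsS.add (((hvn.hasSum.add hw.hasSum).mul_left (C / L)))
  have hle := hasSum_le hbound hs1.hasSum hs2
  have : C / L * ((∑' x, h x * |v n x| ^ p) + ∑' x, h x * |w x| ^ p) ≤ C / L * (K' + K') := by
    apply mul_le_mul_of_nonneg_left _ (by positivity)
    exact add_le_add (hKn.trans (le_max_left _ _)) (le_max_right _ _)
  have h3 : C / L * (K' + K') ≤ ε / 2 := by
    rw [div_mul_eq_mul_div, div_le_iff₀ hLpos, hL]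
    have : ε / 2 * (1 + 4 * C * K' / ε) = ε / 2 + 2 * C * K' := by field_simp; ring
    rw [this]; nlinarith
  linarith

end HOK

/-- Standing assumptions on the interaction kernel (with the diagonal removed). -/
structure VOK (V : Z d → Z d → ℝ) : Prop where
  symm : ∀ x y, V x y = V y x
  nonneg : ∀ x y, 0 ≤ V x y
  diag : ∀ x, V x x = 0
  pos : ∀ x y, x ≠ y → 0 < V x y
  sum : ∀ x, Summable fun y => V x y

/-- Squared gradient. -/
def EE (V : Z d → Z d → ℝ) (u : Z d → ℝ) (z : Z d) : ℝ :=
  (1 / 2) * ∑' y, V z y * (u z - u y) ^ 2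

namespace VOK

variable {V : Z d → Z d → ℝ} {h : Z d → ℝ} {h₀ p : ℝ} {u v : Z d → ℝ}

lemma term_nonneg (H : VOK V) (u : Z d → ℝ) (z y : Z d) : 0 ≤ V z y * (u z - u y) ^ 2 :=
  mul_nonneg (H.nonneg _ _) (sq_nonneg _)

lemma EE_nonneg (H : VOK V) (u : Z d → ℝ) (z : Z d) : 0 ≤ EE V u z :=
  mul_nonneg (by norm_num) (tsum_nonneg fun y => H.term_nonneg u z y)

lemma gradNorm_nonneg (u : Z d → ℝ) (z : Z d) : 0 ≤ gradNorm V u z := Real.sqrt_nonneg _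

lemma gradNorm_rpow (H : VOK V) (u : Z d → ℝ) (z : Z d) (q : ℝ) :
    gradNorm V u z ^ q = EE V u z ^ (q / 2) := by
  have : gradNorm V u z = EE V u z ^ (1 / 2 : ℝ) := by
    rw [← Real.sqrt_eq_rpow]; rfl
  rw [this, ← Real.rpow_mul (H.EE_nonneg u z)]
  congr 1; ring

lemma gp_nonneg (u : Z d → ℝ) (z : Z d) (q : ℝ) : 0 ≤ gradNorm V u z ^ q :=
  Real.rpow_nonneg (gradNorm_nonneg u z) _

lemma mem_h (Hh : HOK h h₀ p) (hu : memH V h p u) : Summable fun x => h x * |u x| ^ p :=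
  Summable.of_nonneg_of_le (fun x => Hh.term_nonneg u x)
    (fun x => le_add_of_nonneg_left (gp_nonneg u x p)) hu.2

lemma mem_g (Hh : HOK h h₀ p) (hu : memH V h p u) : Summable fun x => gradNorm V u x ^ p :=
  Summable.of_nonneg_of_le (fun x => gp_nonneg u x p)
    (fun x => le_add_of_nonneg_right (Hh.term_nonneg u x)) hu.2

lemma hsum_le (Hh : HOK h h₀ p) (hu : memH V h p u) :
    ∑' x, h x * |u x| ^ p ≤ HnormP V h p u :=
  (mem_h Hh hu).tsum_le_tsum (fun x => le_add_of_nonneg_left (gp_nonneg u x p)) hu.2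

lemma HnormP_nonneg (Hh : HOK h h₀ p) (u : Z d → ℝ) : 0 ≤ HnormP V h p u :=
  tsum_nonneg fun x => add_nonneg (gp_nonneg u x p) (Hh.term_nonneg u x)

lemma HnormP_pos (Hh : HOK h h₀ p) (hu : memH V h p u) (h0 : u ≠ 0) : 0 < HnormP V h p u := by
  obtain ⟨x, hx⟩ := Function.ne_iff.1 h0
  have h1 : 0 < h x * |u x| ^ p :=
    mul_pos (Hh.h_pos x) (Real.rpow_pos_of_pos (abs_pos.2 hx) _)
  exact h1.trans_le (((mem_h Hh hu).le_tsum x fun y _ => Hh.term_nonneg u y).trans (hsum_le Hh hu))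

/-- Comparison. -/
lemma mem_of_le (H : VOK V) (Hh : HOK h h₀ p) (hu : memH V h p u)
    (h1 : ∀ x y, |v x - v y| ≤ |u x - u y|) (h2 : ∀ x, |v x| ≤ |u x|) :
    memH V h p v ∧ HnormP V h p v ≤ HnormP V h p u := by
  have ht : ∀ x y, V x y * (v x - v y) ^ 2 ≤ V x y * (u x - u y) ^ 2 := fun x y =>
    mul_le_mul_of_nonneg_left (sq_le_sq.2 (h1 x y)) (H.nonneg x y)
  have hs : ∀ x, Summable fun y => V x y * (v x - v y) ^ 2 := fun x =>
    Summable.of_nonneg_of_le (fun y => H.term_nonneg v x y) (ht x) (hu.1 x)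
  have hg : ∀ x, gradNorm V v x ≤ gradNorm V u x := fun x =>
    Real.sqrt_le_sqrt (mul_le_mul_of_nonneg_left ((hs x).tsum_le_tsum (ht x) (hu.1 x))
      (by norm_num))
  have hle : ∀ x, gradNorm V v x ^ p + h x * |v x| ^ p ≤ gradNorm V u x ^ p + h x * |u x| ^ p :=
    fun x => add_le_add (Real.rpow_le_rpow (gradNorm_nonneg v x) (hg x) Hh.p_pos.le)
      (mul_le_mul_of_nonneg_left (Real.rpow_le_rpow (abs_nonneg _) (h2 x) Hh.p_pos.le)
        (Hh.h_pos x).le)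
  have hs2 : Summable fun x => gradNorm V v x ^ p + h x * |v x| ^ p :=
    Summable.of_nonneg_of_le (fun x => add_nonneg (gp_nonneg v x p) (Hh.term_nonneg v x)) hle hu.2
  exact ⟨⟨hs, hs2⟩, hs2.tsum_le_tsum hle hu.2⟩

lemma gradNorm_smul {t : ℝ} (ht : 0 ≤ t) (u : Z d → ℝ) (x : Z d) :
    gradNorm V (fun x => t * u x) x = t * gradNorm V u x := by
  unfold gradNorm
  have : (1 / 2) * ∑' y, V x y * (t * u x - t * u y) ^ 2 =
      t ^ 2 * ((1 / 2) * ∑' y, V x y * (u x - u y) ^ 2) := by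
    rw [mul_left_comm, ← tsum_mul_left (a := t ^ 2)]
    congr 1
    exact tsum_congr fun y => by ring
  rw [this, Real.sqrt_mul (sq_nonneg t), Real.sqrt_sq ht]

lemma smul_term {t : ℝ} (ht : 0 ≤ t) (u : Z d → ℝ) (x : Z d) :
    gradNorm V (fun x => t * u x) x ^ p + h x * |t * u x| ^ p =
      t ^ p * (gradNorm V u x ^ p + h x * |u x| ^ p) := by
  rw [gradNorm_smul ht, Real.mul_rpow ht (gradNorm_nonneg u x), abs_mul, abs_of_nonneg ht,
    Real.mul_rpow ht (abs_nonneg _)]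
  ring

lemma mem_smul {t : ℝ} (ht : 0 ≤ t) (hu : memH V h p u) : memH V h p (fun x => t * u x) := by
  refine ⟨fun x => ?_, ?_⟩
  · have := (hu.1 x).mul_left (t ^ 2)
    refine this.congr fun y => ?_
    ring
  · refine (hu.2.mul_left (t ^ p)).congr fun x => ?_
    exact (smul_term ht u x).symm

lemma HnormP_smul {t : ℝ} (ht : 0 ≤ t) (u : Z d → ℝ) :
    HnormP V h p (fun x => t * u x) = t ^ p * HnormP V h p u := by
  unfold HnormP
  rw [← tsum_mul_left]
  exact tsum_congr fun x => smul_term ht u x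

lemma rpow_add_le {a b q : ℝ} (ha : 0 ≤ a) (hb : 0 ≤ b) (hq : 0 ≤ q) :
    (a + b) ^ q ≤ 2 ^ q * (a ^ q + b ^ q) := by
  have h1 : a + b ≤ 2 * max a b := by
    have := le_max_left a b; have := le_max_right a b; linarith
  calc (a + b) ^ q ≤ (2 * max a b) ^ q := Real.rpow_le_rpow (add_nonneg ha hb) h1 hq
    _ = 2 ^ q * (max a b) ^ q := Real.mul_rpow (by norm_num) (le_max_of_le_left ha)
    _ ≤ _ := by
      apply mul_le_mul_of_nonneg_left _ (by positivity)
      rcases le_total a b with hab | hab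
      · rw [max_eq_right hab]; have := Real.rpow_nonneg ha q; linarith
      · rw [max_eq_left hab]; have := Real.rpow_nonneg hb q; linarith

lemma mem_add (H : VOK V) (Hh : HOK h h₀ p) (hu : memH V h p u) (hv : memH V h p v) :
    memH V h p (fun x => u x + v x) := by
  have ht : ∀ x y, V x y * ((u x + v x) - (u y + v y)) ^ 2 ≤
      2 * (V x y * (u x - u y) ^ 2) + 2 * (V x y * (v x - v y) ^ 2) := by
    intro x y
    have := H.nonneg x y
    have h2 : ((u x + v x) - (u y + v y)) ^ 2 ≤ 2 * (u x - u y) ^ 2 + 2 * (v x - v y) ^ 2 := by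
      nlinarith [sq_nonneg ((u x - u y) - (v x - v y))]
    nlinarith [mul_le_mul_of_nonneg_left h2 this]
  have hs : ∀ x, Summable fun y => V x y * ((u x + v x) - (u y + v y)) ^ 2 := fun x =>
    Summable.of_nonneg_of_le (fun y => H.term_nonneg (fun x => u x + v x) x y) (ht x)
      (((hu.1 x).mul_left 2).add ((hv.1 x).mul_left 2))
  have hE : ∀ x, EE V (fun x => u x + v x) x ≤ 2 * EE V u x + 2 * EE V v x := by
    intro x
    have := (hs x).tsum_le_tsum (ht x) (((hu.1 x).mul_left 2).add ((hv.1 x).mul_left 2))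
    rw [((hu.1 x).mul_left 2).tsum_add ((hv.1 x).mul_left 2), tsum_mul_left, tsum_mul_left] at this
    unfold EE
    linarith
  have hp := Hh.p_pos
  refine ⟨hs, Summable.add ?_ ?_⟩
  · refine Summable.of_nonneg_of_le (fun x => gp_nonneg _ x p) (fun x => ?_)
      (((mem_g Hh hu).add (mem_g Hh hv)).mul_left (2 ^ (p / 2) * 2 ^ (p / 2)))
    rw [H.gradNorm_rpow, H.gradNorm_rpow, H.gradNorm_rpow]
    have a1 := H.EE_nonneg u x
    have a2 := H.EE_nonneg v x
    calc EE V (fun x => u x + v x) x ^ (p / 2) ≤ (2 * EE V u x + 2 * EE V v x) ^ (p / 2) :=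
          Real.rpow_le_rpow (H.EE_nonneg _ x) (hE x) (by positivity)
      _ ≤ 2 ^ (p / 2) * ((2 * EE V u x) ^ (p / 2) + (2 * EE V v x) ^ (p / 2)) :=
          rpow_add_le (by positivity) (by positivity) (by positivity)
      _ = _ := by
        rw [Real.mul_rpow (by norm_num) a1, Real.mul_rpow (by norm_num) a2]; ring
  · refine Summable.of_nonneg_of_le (fun x => Hh.term_nonneg (fun x => u x + v x) x) (fun x => ?_)
      (((mem_h Hh hu).add (mem_h Hh hv)).mul_left (2 ^ p))
    have a1 := rpow_add_le (abs_nonneg (u x)) (abs_nonneg (v x)) hp.le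
    have a2 : |u x + v x| ^ p ≤ (|u x| + |v x|) ^ p :=
      Real.rpow_le_rpow (abs_nonneg _) (abs_add_le _ _) hp.le
    have := mul_le_mul_of_nonneg_left (a2.trans a1) (Hh.h_pos x).le
    linarith

/-- The unit mass at `x`. -/
def dlt (x : Z d) : Z d → ℝ := fun y => if y = x then 1 else 0

lemma dlt_row (H : VOK V) (x z : Z d) : Summable fun y => V z y * (dlt x z - dlt x y) ^ 2 := by
  refine Summable.of_nonneg_of_le (fun y => H.term_nonneg _ z y) (fun y => ?_) (H.sum z)
  have : (dlt x z - dlt x y) ^ 2 ≤ 1 := by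
    unfold dlt; split_ifs <;> norm_num
  nlinarith [H.nonneg z y]

lemma EE_dlt_of_ne (H : VOK V) {x z : Z d} (hz : z ≠ x) : EE V (dlt x) z = (1 / 2) * V x z := by
  unfold EE
  rw [tsum_eq_single x]
  · simp [dlt, hz, H.symm z x]
  · intro y hy
    simp [dlt, hz, hy]

lemma mem_dlt (H : VOK V) (Hh : HOK h h₀ p) (hp : 2 ≤ p) (x : Z d) : memH V h p (dlt x) := by
  refine ⟨fun z => H.dlt_row x z, Summable.add ?_ ?_⟩
  · -- bounded by row of `x`
    set M := ∑' y, V x y with hM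
    have hM0 : 0 ≤ M := tsum_nonneg fun y => H.nonneg x y
    have hb : ∀ z, z ≠ x → gradNorm V (dlt x) z ^ p ≤ (M + 1) ^ (p / 2 - 1) * V x z := by
      intro z hz
      rw [H.gradNorm_rpow, H.EE_dlt_of_ne hz]
      have hv := H.nonneg x z
      have hvM : V x z ≤ M := (H.sum x).le_tsum z fun y _ => H.nonneg x y
      rcases hv.eq_or_lt with h0 | h0
      · rw [← h0, mul_zero, mul_zero, Real.zero_rpow (by linarith)]
      have h1 : 0 < 1 / 2 * V x z := by positivity
      have e : (1 / 2 * V x z) ^ (p / 2) = (1 / 2 * V x z) ^ (p / 2 - 1) * (1 / 2 * V x z) := by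
        rw [← Real.rpow_add_one h1.ne']; congr 1; ring
      rw [e]
      apply mul_le_mul _ (by linarith) h1.le (by positivity)
      exact Real.rpow_le_rpow h1.le (by linarith) (by linarith)
    have hsum := ((H.sum x).mul_left ((M + 1) ^ (p / 2 - 1)))
    refine Summable.of_norm_bounded_eventually hsum ?_
    have : {z : Z d | ¬ ‖gradNorm V (dlt x) z ^ p‖ ≤ (M + 1) ^ (p / 2 - 1) * V x z} ⊆ {x} := by
      intro z hz
      by_contra hc
      exact hz (by
        rw [Real.norm_eq_abs, abs_of_nonneg (gp_nonneg _ z p)]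
        exact hb z hc)
    exact (Set.finite_singleton x).subset this
  · apply summable_of_ne_finset_zero (s := {x})
    intro z hz
    simp only [Finset.mem_singleton] at hz
    simp [dlt, hz, Real.zero_rpow Hh.p_pos.ne']

/-- Fatou's lemma for the norm. -/
lemma fatou (H : VOK V) (Hh : HOK h h₀ p) {ι : Type*} {l : Filter ι} [l.NeBot]
    {vn : ι → Z d → ℝ} {w : Z d → ℝ} {K : ℝ} (hv : ∀ᶠ n in l, memH V h p (vn n))
    (hK : ∀ᶠ n in l, HnormP V h p (vn n) ≤ K)
    (hlim : ∀ x, Tendsto (fun n => vn n x) l (𝓝 (w x))) :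
    memH V h p w ∧ HnormP V h p w ≤ K := by
  have hp := Hh.p_pos
  -- finite truncations
  have hfin : ∀ S T : Finset (Z d), ∑ x ∈ S, (((1 / 2) * ∑ y ∈ T, V x y * (w x - w y) ^ 2) ^ (p / 2)
      + h x * |w x| ^ p) ≤ K := by
    intro S T
    have ht : Tendsto (fun n => ∑ x ∈ S,
        (((1 / 2) * ∑ y ∈ T, V x y * (vn n x - vn n y) ^ 2) ^ (p / 2) + h x * |vn n x| ^ p)) l
        (𝓝 (∑ x ∈ S, (((1 / 2) * ∑ y ∈ T, V x y * (w x - w y) ^ 2) ^ (p / 2)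
          + h x * |w x| ^ p))) := by
      refine tendsto_finsetSum _ fun x _ => Tendsto.add ?_ ?_
      · refine Tendsto.rpow_const ?_ (Or.inr (by positivity))
        refine Tendsto.const_mul _ (tendsto_finsetSum _ fun y _ => ?_)
        exact (((hlim x).sub (hlim y)).pow 2).const_mul _
      · exact ((hlim x).abs.rpow_const (Or.inr hp.le)).const_mul _
    refine le_of_tendsto ht ?_
    filter_upwards [hv, hK] with n hn hKn
    refine le_trans ?_ hKn
    refine le_trans (Finset.sum_le_sum fun x _ => ?_)
      (hn.2.sum_le_tsum S fun x _ => add_nonneg (gp_nonneg _ x p) (Hh.term_nonneg _ x))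
    refine add_le_add ?_ le_rfl
    rw [H.gradNorm_rpow]
    refine Real.rpow_le_rpow ?_ ?_ (by positivity)
    · exact mul_nonneg (by norm_num) (Finset.sum_nonneg fun y _ => H.term_nonneg _ x y)
    · exact mul_le_mul_of_nonneg_left ((hn.1 x).sum_le_tsum T fun y _ => H.term_nonneg _ x y)
        (by norm_num)
  have hK0 : 0 ≤ K := by simpa using hfin ∅ ∅
  have hrow : ∀ x, Summable fun y => V x y * (w x - w y) ^ 2 := by
    intro x
    refine summable_of_sum_le (c := 2 * K ^ (2 / p)) (fun y => H.term_nonneg w x y) fun T => ?_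
    have h1 := hfin {x} T
    rw [Finset.sum_singleton] at h1
    have h2 : 0 ≤ ∑ y ∈ T, V x y * (w x - w y) ^ 2 :=
      Finset.sum_nonneg fun y _ => H.term_nonneg _ x y
    have h3 : ((1 / 2) * ∑ y ∈ T, V x y * (w x - w y) ^ 2) ^ (p / 2) ≤ K := by
      linarith [Hh.term_nonneg w x]
    have h4 := Real.rpow_le_rpow (by positivity) h3 (by positivity : 0 ≤ 2 / p)
    rw [← Real.rpow_mul (by positivity)] at h4
    have e : p / 2 * (2 / p) = 1 := by field_simp
    rw [e, Real.rpow_one] at h4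
    linarith
  have hfin2 : ∀ S : Finset (Z d), ∑ x ∈ S, (gradNorm V w x ^ p + h x * |w x| ^ p) ≤ K := by
    intro S
    have ht : Tendsto (fun T : Finset (Z d) => ∑ x ∈ S,
        (((1 / 2) * ∑ y ∈ T, V x y * (w x - w y) ^ 2) ^ (p / 2) + h x * |w x| ^ p)) atTop
        (𝓝 (∑ x ∈ S, (gradNorm V w x ^ p + h x * |w x| ^ p))) := by
      refine tendsto_finsetSum _ fun x _ => Tendsto.add ?_ tendsto_const_nhds
      rw [H.gradNorm_rpow]
      refine Tendsto.rpow_const ?_ (Or.inr (by positivity))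
      exact Tendsto.const_mul _ (hrow x).hasSum
    exact le_of_tendsto ht (Eventually.of_forall fun T => hfin S T)
  have hnn : ∀ x, 0 ≤ gradNorm V w x ^ p + h x * |w x| ^ p := fun x =>
    add_nonneg (gp_nonneg w x p) (Hh.term_nonneg w x)
  have hs : Summable fun x => gradNorm V w x ^ p + h x * |w x| ^ p :=
    summable_of_sum_le hnn hfin2
  exact ⟨⟨hrow, hs⟩, hs.tsum_le_of_sum_le hfin2⟩

end VOK

namespace ROK

variable {R : Z d → Z d → ℝ} {R0 : ℝ} {a b c : Z d → ℝ}

lemma bil_add_left (H : ROK R R0) (ha : Summable fun x => |a x|) (hb : Summable fun x => |b x|)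
    (hc : Summable fun x => |c x|) :
    bil R (fun y => a y + b y) c = bil R a c + bil R b c := by
  have hb' : Summable fun x => |(- b x)| := by simpa using hb
  have h1 := H.bil_sub_left ha hb' hc
  have h0 : Summable fun x : Z d => |(0:ℝ)| := by simp
  have h2 := H.bil_sub_left h0 hb hc
  have h3 : bil R (fun _ : Z d => (0:ℝ)) c = 0 := by simp [bil, cv]
  simp only [sub_neg_eq_add, zero_sub] at h1 h2
  rw [h1, h2, h3]; ring

lemma bil_mul_right (k : ℝ) : bil R a (fun y => k * c y) = k * bil R a c := by
  unfold bil
  rw [← tsum_mul_left]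
  exact tsum_congr fun y => by ring

lemma L1.add {ι : Type*} {l : Filter ι} {an bn : ι → Z d → ℝ} (ha : L1 l an a) (hb : L1 l bn b) :
    L1 l (fun n x => an n x + bn n x) (fun x => a x + b x) := by
  refine ⟨?_, summable_abs_add ha.2.1 hb.2.1, ?_⟩
  · filter_upwards [ha.1, hb.1] with n h1 h2 using summable_abs_add h1 h2
  · refine tendsto_of_tendsto_of_tendsto_of_le_of_le' tendsto_const_nhds
      (by simpa using ha.2.2.add hb.2.2)
      (Eventually.of_forall fun n => tsum_nonneg fun _ => abs_nonneg _) ?_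
    filter_upwards [ha.1, hb.1] with n h1 h2
    have s1 := summable_abs_sub h1 ha.2.1
    have s2 := summable_abs_sub h2 hb.2.1
    rw [← s1.tsum_add s2]
    refine Summable.tsum_le_tsum (fun x => ?_)
      (summable_abs_sub (summable_abs_add h1 h2) (summable_abs_add ha.2.1 hb.2.1)) (s1.add s2)
    have : an n x + bn n x - (a x + b x) = (an n x - a x) + (bn n x - b x) := by ring
    rw [this]; exact abs_add_le _ _

lemma L1.const {ι : Type*} {l : Filter ι} (ha : Summable fun x => |a x|) :
    L1 l (fun _ => a) a := by
  refine ⟨Eventually.of_forall fun _ => ha, ha, ?_⟩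
  simp only [sub_self, abs_zero, tsum_zero]
  exact tendsto_const_nhds

lemma L1.of_dominated {ι : Type*} {l : Filter ι} {an : ι → Z d → ℝ} {g : Z d → ℝ}
    (hg : Summable g) (ha : ∀ x, |a x| ≤ g x) (hb : ∀ᶠ n in l, ∀ x, |an n x| ≤ g x)
    (hlim : ∀ x, Tendsto (fun n => an n x) l (𝓝 (a x))) : L1 l an a := by
  refine ⟨hb.mono fun n hn => Summable.of_nonneg_of_le (fun _ => abs_nonneg _) hn hg,
    Summable.of_nonneg_of_le (fun _ => abs_nonneg _) ha hg, ?_⟩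
  have : Tendsto (fun n => ∑' x, |an n x - a x|) l (𝓝 (∑' x : Z d, (0:ℝ))) := by
    refine tendsto_tsum_of_dominated_convergence (bound := fun x => 2 * g x) (hg.mul_left 2)
      (fun x => ?_) ?_
    · have := ((hlim x).sub (tendsto_const_nhds (x := a x))).abs
      simpa using this
    · filter_upwards [hb] with n hn x
      rw [Real.norm_eq_abs, abs_abs]
      have := abs_sub (an n x) (a x)
      linarith [hn x, ha x]
  simpa using this

end ROK

/-- Standing context. -/
structure Ctx (V R : Z d → Z d → ℝ) (R0 : ℝ) (h : Z d → ℝ) (h₀ p : ℝ) (f : ℝ → ℝ) (θ : ℝ) :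
    Prop where
  fpos : ∀ t > 0, 0 < Fint f t
  v : VOK V
  r : ROK R R0
  h : HOK h h₀ p
  f : FOK f p θ
  rdiag : ∀ x, 0 < R x x

/-- `∑ (R∗F(u⁺)) f(u⁺) u⁺`. -/
def AA (R : Z d → Z d → ℝ) (f : ℝ → ℝ) (u : Z d → ℝ) : ℝ :=
  bil R (fun x => Phi f (u x)) (fun x => Psi f (u x))

/-- `∑ (R∗F(u⁺)) F(u⁺)`. -/
def DD (R : Z d → Z d → ℝ) (f : ℝ → ℝ) (u : Z d → ℝ) : ℝ :=
  bil R (fun x => Phi f (u x)) (fun x => Phi f (u x))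

/-- The energy. -/
def JJ (V R : Z d → Z d → ℝ) (h : Z d → ℝ) (p : ℝ) (f : ℝ → ℝ) (u : Z d → ℝ) : ℝ :=
  (1 / p) * HnormP V h p u - (1 / 2) * DD R f u

namespace Ctx

variable {V R : Z d → Z d → ℝ} {R0 : ℝ} {h : Z d → ℝ} {h₀ p : ℝ} {f : ℝ → ℝ} {θ : ℝ}
  {u : Z d → ℝ}

lemma locPhi (H : Ctx V R R0 h h₀ p f θ) : HOK.LocP (Phi f) p := fun m => by
  obtain ⟨C, hC, _, h1, _⟩ := H.f.loc m
  exact ⟨C, hC, h1⟩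

lemma locPsi (H : Ctx V R R0 h h₀ p f θ) : HOK.LocP (Psi f) p := fun m => by
  obtain ⟨C, hC, _, _, h1⟩ := H.f.loc m
  exact ⟨C, hC, h1⟩

lemma sPhi (H : Ctx V R R0 h h₀ p f θ) (hu : memH V h p u) : Summable fun x => |Phi f (u x)| :=
  H.h.summable_comp H.locPhi (VOK.mem_h H.h hu)

lemma sPsi (H : Ctx V R R0 h h₀ p f θ) (hu : memH V h p u) : Summable fun x => |Psi f (u x)| :=
  H.h.summable_comp H.locPsi (VOK.mem_h H.h hu)

lemma L1Phi (H : Ctx V R R0 h h₀ p f θ) {ι : Type*} {l : Filter ι} {v : ι → Z d → ℝ}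
    {w : Z d → ℝ} {K : ℝ} (hw : memH V h p w) (hv : ∀ᶠ n in l, memH V h p (v n))
    (hK : ∀ᶠ n in l, HnormP V h p (v n) ≤ K)
    (hlim : ∀ x, Tendsto (fun n => v n x) l (𝓝 (w x))) :
    ROK.L1 l (fun n x => Phi f (v n x)) (fun x => Phi f (w x)) := by
  refine H.h.L1_comp (K := K) H.f.Phi_cont H.locPhi (VOK.mem_h H.h hw)
    (hv.mono fun n hn => VOK.mem_h H.h hn) ?_ hlim
  filter_upwards [hv, hK] with n h1 h2 using (VOK.hsum_le H.h h1).trans h2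

lemma L1Psi (H : Ctx V R R0 h h₀ p f θ) {ι : Type*} {l : Filter ι} {v : ι → Z d → ℝ}
    {w : Z d → ℝ} {K : ℝ} (hw : memH V h p w) (hv : ∀ᶠ n in l, memH V h p (v n))
    (hK : ∀ᶠ n in l, HnormP V h p (v n) ≤ K)
    (hlim : ∀ x, Tendsto (fun n => v n x) l (𝓝 (w x))) :
    ROK.L1 l (fun n x => Psi f (v n x)) (fun x => Psi f (w x)) := by
  refine H.h.L1_comp (K := K) H.f.Psi_cont H.locPsi (VOK.mem_h H.h hw)
    (hv.mono fun n hn => VOK.mem_h H.h hn) ?_ hlim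
  filter_upwards [hv, hK] with n h1 h2 using (VOK.hsum_le H.h h1).trans h2

lemma tendsto_AA (H : Ctx V R R0 h h₀ p f θ) {ι : Type*} {l : Filter ι} {v : ι → Z d → ℝ}
    {w : Z d → ℝ} {K : ℝ} (hw : memH V h p w) (hv : ∀ᶠ n in l, memH V h p (v n))
    (hK : ∀ᶠ n in l, HnormP V h p (v n) ≤ K)
    (hlim : ∀ x, Tendsto (fun n => v n x) l (𝓝 (w x))) :
    Tendsto (fun n => AA R f (v n)) l (𝓝 (AA R f w)) :=
  H.r.tendsto_bil (H.L1Phi hw hv hK hlim) (H.L1Psi hw hv hK hlim)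

lemma tendsto_DD (H : Ctx V R R0 h h₀ p f θ) {ι : Type*} {l : Filter ι} {v : ι → Z d → ℝ}
    {w : Z d → ℝ} {K : ℝ} (hw : memH V h p w) (hv : ∀ᶠ n in l, memH V h p (v n))
    (hK : ∀ᶠ n in l, HnormP V h p (v n) ≤ K)
    (hlim : ∀ x, Tendsto (fun n => v n x) l (𝓝 (w x))) :
    Tendsto (fun n => DD R f (v n)) l (𝓝 (DD R f w)) :=
  H.r.tendsto_bil (H.L1Phi hw hv hK hlim) (H.L1Phi hw hv hK hlim)

lemma AA_ge (H : Ctx V R R0 h h₀ p f θ) (hu : memH V h p u) (x : Z d) :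
    R x x * Phi f (u x) * Psi f (u x) ≤ AA R f u := by
  have hcv : R x x * Phi f (u x) ≤ cv R (fun x => Phi f (u x)) x :=
    (H.r.summable_cv (H.sPhi hu) x).le_tsum x
      fun y _ => mul_nonneg (H.r.nonneg _ _) (H.f.Phi_nonneg _)
  refine (mul_le_mul_of_nonneg_right hcv (H.f.Psi_nonneg _)).trans ?_
  exact (H.r.summable_bil (H.sPhi hu) (H.sPsi hu)).le_tsum x
    fun y _ => mul_nonneg (H.r.cv_nonneg (fun _ => H.f.Phi_nonneg _) _) (H.f.Psi_nonneg _)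

lemma DD_le (H : Ctx V R R0 h h₀ p f θ) (hu : memH V h p u) :
    θ * DD R f u ≤ 2 * AA R f u := by
  unfold DD AA bil
  rw [← tsum_mul_left, ← tsum_mul_left]
  refine Summable.tsum_le_tsum (fun x => ?_)
    ((H.r.summable_bil (H.sPhi hu) (H.sPhi hu)).mul_left θ)
    ((H.r.summable_bil (H.sPhi hu) (H.sPsi hu)).mul_left 2)
  have h1 := H.r.cv_nonneg (a := fun x => Phi f (u x)) (fun _ => H.f.Phi_nonneg _) x
  have := mul_le_mul_of_nonneg_left (H.f.ar (u x)) h1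
  linarith

lemma AA_le (H : Ctx V R R0 h h₀ p f θ) :
    ∃ C : ℝ, 0 < C ∧ ∀ u : Z d → ℝ, memH V h p u → HnormP V h p u ≤ 1 →
      AA R f u ≤ C * HnormP V h p u ^ 2 := by
  obtain ⟨C, hC, _, h1, h2⟩ := H.f.loc ((1 / h₀) ^ (1 / p))
  have hR := H.r.R0_nonneg
  have hh := H.h.pos
  refine ⟨R0 * (C * (1 / h₀)) ^ 2 + 1, by positivity, fun u hu hN => ?_⟩
  have hsum := VOK.mem_h H.h hu
  have habs : ∀ x, |u x| ≤ (1 / h₀) ^ (1 / p) :=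
    H.h.abs_le hsum ((VOK.hsum_le H.h hu).trans hN)
  have hq : ∑' x, |u x| ^ p ≤ (1 / h₀) * HnormP V h p u :=
    (H.h.tsum_rpow_le hsum).trans
      (mul_le_mul_of_nonneg_left (VOK.hsum_le H.h hu) (by positivity))
  have b1 : ∑' x, |Phi f (u x)| ≤ C * ((1 / h₀) * HnormP V h p u) := by
    refine le_trans ?_ (mul_le_mul_of_nonneg_left hq hC)
    rw [← tsum_mul_left]
    exact (H.sPhi hu).tsum_le_tsum (fun x => h1 _ (habs x)) ((H.h.summable_rpow hsum).mul_left C)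
  have b2 : ∑' x, |Psi f (u x)| ≤ C * ((1 / h₀) * HnormP V h p u) := by
    refine le_trans ?_ (mul_le_mul_of_nonneg_left hq hC)
    rw [← tsum_mul_left]
    exact (H.sPsi hu).tsum_le_tsum (fun x => h2 _ (habs x)) ((H.h.summable_rpow hsum).mul_left C)
  have hN0 := VOK.HnormP_nonneg (V := V) H.h u
  have key := (le_abs_self _).trans (H.r.abs_bil_le (H.sPhi hu) (H.sPsi hu))
  have n2 : 0 ≤ ∑' x, |Psi f (u x)| := tsum_nonneg fun _ => abs_nonneg _
  calc AA R f u ≤ R0 * (∑' x, |Phi f (u x)|) * ∑' x, |Psi f (u x)| := key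
    _ ≤ R0 * (C * ((1 / h₀) * HnormP V h p u)) * (C * ((1 / h₀) * HnormP V h p u)) :=
        mul_le_mul (mul_le_mul_of_nonneg_left b1 hR) b2 n2 (by positivity)
    _ = R0 * (C * (1 / h₀)) ^ 2 * HnormP V h p u ^ 2 := by ring
    _ ≤ _ := by nlinarith [sq_nonneg (HnormP V h p u)]

lemma AA_zero_of_pos (hp0 : pos u = 0) : AA R f u = 0 := by
  have : ∀ x, max (u x) 0 = 0 := fun x => congrFun hp0 x
  unfold AA bil Psi
  simp [this]

end Ctx

/-- (f4), in normalized form. -/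
def Mono4 (V R : Z d → Z d → ℝ) (h : Z d → ℝ) (p : ℝ) (f : ℝ → ℝ) : Prop :=
  ∀ u, memH V h p u → pos u ≠ 0 →
    StrictMonoOn (fun t : ℝ => t ^ (-p) * AA R f (fun x => t * u x)) (Set.Ioi 0)

namespace Ctx

variable {V R : Z d → Z d → ℝ} {R0 : ℝ} {h : Z d → ℝ} {h₀ p : ℝ} {f : ℝ → ℝ} {θ : ℝ}
  {u : Z d → ℝ}

lemma bdd_scale (H : Ctx V R R0 h h₀ p f θ) (u : Z d → ℝ) {s : ℝ} (hs : 0 < s) :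
    ∀ᶠ t in 𝓝 s, HnormP V h p (fun x => t * u x) ≤ (2 * s) ^ p * HnormP V h p u := by
  filter_upwards [lt_mem_nhds hs, gt_mem_nhds (by linarith : s < 2 * s)] with t ht ht2
  rw [VOK.HnormP_smul ht.le]
  exact mul_le_mul_of_nonneg_right (Real.rpow_le_rpow ht.le ht2.le H.h.p_pos.le)
    (VOK.HnormP_nonneg H.h u)

lemma mem_scale (hu : memH V h p u) {s : ℝ} (hs : 0 < s) :
    ∀ᶠ t in 𝓝 s, memH V h p (fun x => t * u x) := by
  filter_upwards [lt_mem_nhds hs] with t ht using VOK.mem_smul ht.le hu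

lemma cont_AA_scale (H : Ctx V R R0 h h₀ p f θ) (hu : memH V h p u) {s : ℝ} (hs : 0 < s) :
    ContinuousAt (fun t : ℝ => AA R f (fun x => t * u x)) s :=
  H.tendsto_AA (VOK.mem_smul hs.le hu) (mem_scale hu hs) (H.bdd_scale u hs)
    (fun x => (continuous_id.mul continuous_const).tendsto s)

lemma exists_pos_of_pos (hp0 : pos u ≠ 0) : ∃ x, 0 < u x := by
  obtain ⟨x, hx⟩ := Function.ne_iff.1 hp0
  refine ⟨x, ?_⟩
  by_contra hc
  push Not at hc
  exact hx (max_eq_right hc)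

lemma AA_large (H : Ctx V R R0 h h₀ p f θ) (hu : memH V h p u) (hp0 : pos u ≠ 0) (B : ℝ) :
    ∀ᶠ t : ℝ in atTop, t ^ p * B ≤ AA R f (fun x => t * u x) := by
  obtain ⟨x, hx⟩ := exists_pos_of_pos hp0
  have hθ : 0 < θ := by linarith [H.f.lt, H.h.p_pos]
  set κ : ℝ := R x x * (θ / 2) * Fint f 1 ^ 2 * (u x) ^ θ with hκ
  have hκ0 : 0 < κ := by
    have a1 := H.rdiag x
    have a2 := H.fpos 1 one_pos
    have a3 := Real.rpow_pos_of_pos hx θ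
    positivity
  have ht := (tendsto_rpow_atTop (by linarith [H.f.lt] : 0 < θ - p)).eventually_ge_atTop (B / κ)
  filter_upwards [ht, eventually_ge_atTop (1 / u x), eventually_gt_atTop 0] with t h1 h2 h3
  have htu : 1 ≤ t * u x := by rwa [div_le_iff₀ hx] at h2
  have hb : B ≤ t ^ (θ - p) * κ := by rwa [div_le_iff₀ hκ0] at h1
  refine le_trans ?_ (H.AA_ge (VOK.mem_smul h3.le hu) x)
  have htu0 : 0 < t * u x := by linarith
  have e1 : Phi f (t * u x) = Fint f (t * u x) := by unfold Phi; rw [max_eq_left htu0.le]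
  have g1 := H.f.growth htu
  have g2 := H.f.ar (t * u x)
  rw [e1] at g2 ⊢
  have hF1 := H.fpos 1 one_pos
  have hc : 0 < Fint f 1 * (t * u x) ^ (θ / 2) := mul_pos hF1 (Real.rpow_pos_of_pos htu0 _)
  have hF : 0 < Fint f (t * u x) := lt_of_lt_of_le hc g1
  have hsq : (Fint f 1 * (t * u x) ^ (θ / 2)) ^ 2 = Fint f 1 ^ 2 * (t ^ θ * u x ^ θ) := by
    rw [mul_pow, ← Real.rpow_natCast ((t * u x) ^ (θ / 2)), ← Real.rpow_mul htu0.le,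
      ← Real.mul_rpow h3.le hx.le]
    congr 2
    push_cast; ring
  have hsq2 : Fint f 1 ^ 2 * (t ^ θ * u x ^ θ) ≤ Fint f (t * u x) ^ 2 := by
    rw [← hsq]; exact pow_le_pow_left₀ hc.le g1 2
  have htp : 0 < t ^ p := Real.rpow_pos_of_pos h3 _
  calc t ^ p * B ≤ t ^ p * (t ^ (θ - p) * κ) := mul_le_mul_of_nonneg_left hb htp.le
    _ = t ^ θ * κ := by rw [← mul_assoc, ← Real.rpow_add h3]; congr 2; ring
    _ = R x x * (θ / 2) * (Fint f 1 ^ 2 * (t ^ θ * u x ^ θ)) := by rw [hκ]; ring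
    _ ≤ R x x * (θ / 2) * Fint f (t * u x) ^ 2 :=
        mul_le_mul_of_nonneg_left hsq2 (mul_nonneg (H.r.nonneg _ _) (by positivity))
    _ = R x x * Fint f (t * u x) * (θ / 2 * Fint f (t * u x)) := by ring
    _ ≤ _ := mul_le_mul_of_nonneg_left (by linarith)
        (mul_nonneg (H.r.nonneg _ _) hF.le)

lemma ne_zero_of_pos (hp0 : pos u ≠ 0) : u ≠ 0 := by
  obtain ⟨x, hx⟩ := exists_pos_of_pos hp0
  rintro rfl
  simp at hx

lemma pos_scale {t : ℝ} (ht : 0 < t) (hp0 : pos u ≠ 0) : pos (fun x => t * u x) ≠ 0 := by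
  obtain ⟨x, hx⟩ := exists_pos_of_pos hp0
  intro hc
  have := congrFun hc x
  unfold pos at this
  rw [max_eq_left (mul_pos ht hx).le] at this
  exact (mul_pos ht hx).ne' this

lemma exists_scale (H : Ctx V R R0 h h₀ p f θ) (hu : memH V h p u) (hp0 : pos u ≠ 0) :
    ∃ t : ℝ, 0 < t ∧ HnormP V h p (fun x => t * u x) = AA R f (fun x => t * u x) := by
  have hN := VOK.HnormP_pos H.h hu (ne_zero_of_pos hp0)
  set N := HnormP V h p u with hNdef
  have hp := H.h.p_pos
  obtain ⟨C, hC, hA⟩ := H.AA_le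
  -- a small scale
  set q : ℝ := min 1 (1 / C) with hq
  have hq0 : 0 < q := lt_min one_pos (by positivity)
  set t0 : ℝ := (q / N) ^ (1 / p) with ht0
  have ht0pos : 0 < t0 := Real.rpow_pos_of_pos (by positivity) _
  have e0 : t0 ^ p * N = q := by
    rw [ht0, ← Real.rpow_mul (by positivity), one_div_mul_cancel hp.ne', Real.rpow_one]
    field_simp
  have s0 : AA R f (fun x => t0 * u x) ≤ t0 ^ p * N := by
    have e1 : HnormP V h p (fun x => t0 * u x) = q := by
      rw [VOK.HnormP_smul ht0pos.le, e0]
    have := hA _ (VOK.mem_smul ht0pos.le hu) (by rw [e1]; exact min_le_left _ _)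
    rw [e1] at this
    rw [e0]
    have hqC : C * q ≤ 1 := by
      have : q ≤ 1 / C := min_le_right _ _
      rw [le_div_iff₀ hC] at this; linarith
    nlinarith
  obtain ⟨t1, ht1, ht01⟩ := ((H.AA_large hu hp0 N).and (eventually_ge_atTop t0)).exists
  have hcont : ContinuousOn (fun t : ℝ => AA R f (fun x => t * u x) - t ^ p * N)
      (Set.Icc t0 t1) := by
    intro t ht
    have htp : 0 < t := ht0pos.trans_le ht.1
    exact ((H.cont_AA_scale hu htp).sub
      ((Real.continuousAt_rpow_const t p (Or.inl htp.ne')).mul continuousAt_const)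
      ).continuousWithinAt
  obtain ⟨t, ht, hte⟩ := intermediate_value_Icc ht01 hcont
    (show (0:ℝ) ∈ _ from ⟨by linarith, by linarith⟩)
  have htp : 0 < t := ht0pos.trans_le ht.1
  refine ⟨t, htp, ?_⟩
  rw [VOK.HnormP_smul htp.le]
  simp only at hte
  linarith

lemma hasDerivAt_Phi_scale (H : Ctx V R R0 h h₀ p f θ) (a : ℝ) {s : ℝ} (hs : 0 < s) :
    HasDerivAt (fun t : ℝ => Phi f (t * a)) (s⁻¹ * Psi f (s * a)) s := by
  have hd : HasDerivAt (fun t : ℝ => Fint f (t * max a 0)) (f (s * max a 0) * (1 * max a 0)) s :=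
    (H.f.hasDerivAt _).comp s ((hasDerivAt_id s).mul_const _)
  have hmax : ∀ t : ℝ, 0 < t → max (t * a) 0 = t * max a 0 := fun t ht => by
    rw [mul_max_of_nonneg _ _ ht.le, mul_zero]
  have e : s⁻¹ * Psi f (s * a) = f (s * max a 0) * (1 * max a 0) := by
    unfold Psi
    rw [hmax s hs]; field_simp
  rw [e]
  refine hd.congr_of_eventuallyEq ?_
  filter_upwards [lt_mem_nhds hs] with t ht
  unfold Phi
  rw [hmax t ht]

lemma hasDerivAt_DD (H : Ctx V R R0 h h₀ p f θ) (hu : memH V h p u) {s : ℝ} (hs : 0 < s) :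
    HasDerivAt (fun t : ℝ => DD R f (fun x => t * u x))
      (2 * (s⁻¹ * AA R f (fun x => s * u x))) s := by
  rw [hasDerivAt_iff_tendsto_slope]
  have hsum := VOK.mem_h H.h hu
  have hle : 𝓝[≠] s ≤ 𝓝 s := nhdsWithin_le_nhds
  -- first factor
  have L1a : ROK.L1 (𝓝[≠] s) (fun t x => Phi f (t * u x) + Phi f (s * u x))
      (fun x => Phi f (s * u x) + Phi f (s * u x)) := by
    refine ROK.L1.add ?_ (ROK.L1.const (H.sPhi (VOK.mem_smul hs.le hu)))
    exact H.L1Phi (VOK.mem_smul hs.le hu) ((mem_scale hu hs).filter_mono hle)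
      ((H.bdd_scale u hs).filter_mono hle)
      (fun x => ((continuous_id.mul continuous_const).tendsto s).mono_left hle)
  -- second factor
  obtain ⟨m, hm⟩ : ∃ m, ∀ x, |u x| ≤ m := ⟨_, H.h.abs_le hsum le_rfl⟩
  have hm0 : 0 ≤ m := (abs_nonneg _).trans (hm 0)
  obtain ⟨C, hC, _, _, hPsi⟩ := H.f.loc (2 * s * m)
  have hp := H.h.p_pos
  have hbd : ∀ t ∈ Set.Ioo (s / 2) (2 * s), ∀ x,
      |t⁻¹ * Psi f (t * u x)| ≤ (s / 2)⁻¹ * (C * ((2 * s) ^ p * |u x| ^ p)) := by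
    intro t ht x
    have htp : 0 < t := by linarith [ht.1]
    have h1 : |t * u x| ≤ 2 * s * |u x| := by
      rw [abs_mul, abs_of_pos htp]
      exact mul_le_mul_of_nonneg_right ht.2.le (abs_nonneg _)
    have h2 := hPsi (t * u x) (h1.trans (mul_le_mul_of_nonneg_left (hm x) (by linarith)))
    rw [abs_mul, abs_of_pos (inv_pos.2 htp)]
    refine mul_le_mul ?_ (h2.trans ?_) (abs_nonneg _) (by positivity)
    · exact inv_anti₀ (by linarith) ht.1.le
    · refine mul_le_mul_of_nonneg_left ?_ hC
      rw [← Real.mul_rpow (by linarith) (abs_nonneg _)]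
      exact Real.rpow_le_rpow (abs_nonneg _) h1 hp.le
  have hsI : s ∈ Set.Ioo (s / 2) (2 * s) := ⟨by linarith, by linarith⟩
  have L1b : ROK.L1 (𝓝[≠] s) (fun t x => (t - s)⁻¹ * (Phi f (t * u x) - Phi f (s * u x)))
      (fun x => s⁻¹ * Psi f (s * u x)) := by
    refine ROK.L1.of_dominated
      (g := fun x => (s / 2)⁻¹ * (C * ((2 * s) ^ p * |u x| ^ p)))
      ((((H.h.summable_rpow hsum).mul_left _).mul_left _).mul_left _)
      (fun x => hbd s hsI x) ?_ (fun x => ?_)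
    · filter_upwards [hle (Ioo_mem_nhds hsI.1 hsI.2), self_mem_nhdsWithin] with t ht hts x
      have hmv := (convex_Ioo (s / 2) (2 * s)).norm_image_sub_le_of_norm_hasDerivWithin_le
        (f := fun t => Phi f (t * u x)) (f' := fun t => t⁻¹ * Psi f (t * u x))
        (C := (s / 2)⁻¹ * (C * ((2 * s) ^ p * |u x| ^ p)))
        (fun t ht => (H.hasDerivAt_Phi_scale (u x) (by linarith [ht.1])).hasDerivWithinAt)
        (fun t ht => by rw [Real.norm_eq_abs]; exact hbd t ht x) hsI ht
      rw [Real.norm_eq_abs, Real.norm_eq_abs] at hmv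
      have hne : 0 < |t - s| := abs_pos.2 (sub_ne_zero.2 hts)
      rw [abs_mul, abs_inv, inv_mul_le_iff₀ hne]
      linarith
    · have := (hasDerivAt_iff_tendsto_slope.1 (H.hasDerivAt_Phi_scale (u x) hs))
      refine this.congr fun t => ?_
      rw [slope_def_field]; ring
  have key := H.r.tendsto_bil L1a L1b
  have sP := H.sPhi (VOK.mem_smul hs.le hu)
  have sQ := H.sPsi (VOK.mem_smul hs.le hu)
  have e : bil R (fun x => Phi f (s * u x) + Phi f (s * u x)) (fun x => s⁻¹ * Psi f (s * u x)) =
      2 * (s⁻¹ * AA R f (fun x => s * u x)) := by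
    rw [ROK.bil_mul_right, H.r.bil_add_left sP sP sQ]
    unfold AA; ring
  rw [e] at key
  refine key.congr' ?_
  filter_upwards [(mem_scale hu hs).filter_mono hle] with t ht
  have sT := H.sPhi ht
  rw [slope_def_field, ROK.bil_mul_right, H.r.bil_add_left sT sP (ROK.summable_abs_sub sT sP),
    H.r.bil_sub_right sT sT sP, H.r.bil_sub_right sP sT sP, H.r.bil_symm sP sT]
  unfold DD
  ring

lemma hasDerivAt_JJ (H : Ctx V R R0 h h₀ p f θ) (hu : memH V h p u) {s : ℝ} (hs : 0 < s) :
    HasDerivAt (fun t : ℝ => (1 / p) * (t ^ p * HnormP V h p u) -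
      (1 / 2) * DD R f (fun x => t * u x))
      (s ^ (p - 1) * (HnormP V h p u - s ^ (-p) * AA R f (fun x => s * u x))) s := by
  have hp := H.h.p_pos
  have h1 := ((Real.hasDerivAt_rpow_const (x := s) (p := p) (Or.inl hs.ne')).mul_const
    (HnormP V h p u)).const_mul (1 / p)
  have h2 := (H.hasDerivAt_DD hu hs).const_mul (1 / 2)
  convert! h1.sub h2 using 1
  have e : s ^ (p - 1) * s ^ (-p) = s⁻¹ := by
    rw [← Real.rpow_add hs, ← Real.rpow_neg_one]; congr 1; ring
  rw [mul_sub, ← mul_assoc, e]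
  field_simp

lemma fiber_max (H : Ctx V R R0 h h₀ p f θ) (H4 : Mono4 V R h p f) (hu : memH V h p u)
    (hp0 : pos u ≠ 0) (hM : HnormP V h p u = AA R f u) {s : ℝ} (hs : 0 < s) :
    JJ V R h p f (fun x => s * u x) ≤ JJ V R h p f u := by
  set j : ℝ → ℝ := fun t => (1 / p) * (t ^ p * HnormP V h p u) -
      (1 / 2) * DD R f (fun x => t * u x) with hj
  have hjs : JJ V R h p f (fun x => s * u x) = j s := by
    unfold JJ; rw [VOK.HnormP_smul hs.le]
  have hj1 : JJ V R h p f u = j 1 := by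
    unfold JJ; simp [hj]
  rw [hjs, hj1]
  have hd : ∀ t, 0 < t → HasDerivAt j _ t := fun t ht => H.hasDerivAt_JJ hu ht
  have hm := H4 u hu hp0
  have hone : (1:ℝ) ^ (-p) * AA R f (fun x => 1 * u x) = HnormP V h p u := by
    simp [hM]
  rcases le_total s 1 with h1 | h1
  · have : MonotoneOn j (Set.Icc s 1) := by
      apply monotoneOn_of_deriv_nonneg (convex_Icc s 1)
      · intro t ht
        exact (hd t (hs.trans_le ht.1)).continuousAt.continuousWithinAt
      · intro t ht
        rw [interior_Icc] at ht
        exact (hd t (hs.trans ht.1)).differentiableAt.differentiableWithinAt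
      · intro t ht
        rw [interior_Icc] at ht
        have ht0 := hs.trans ht.1
        rw [(hd t ht0).deriv]
        apply mul_nonneg (Real.rpow_nonneg ht0.le _)
        have := hm (Set.mem_Ioi.2 ht0) (Set.mem_Ioi.2 one_pos) ht.2
        simp only at this
        rw [hone] at this
        linarith
    exact this ⟨le_rfl, h1⟩ ⟨h1, le_rfl⟩ h1
  · have : AntitoneOn j (Set.Icc 1 s) := by
      apply antitoneOn_of_deriv_nonpos (convex_Icc 1 s)
      · intro t ht
        exact (hd t (one_pos.trans_le ht.1)).continuousAt.continuousWithinAt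
      · intro t ht
        rw [interior_Icc] at ht
        exact (hd t (one_pos.trans ht.1)).differentiableAt.differentiableWithinAt
      · intro t ht
        rw [interior_Icc] at ht
        have ht0 := one_pos.trans ht.1
        rw [(hd t ht0).deriv]
        apply mul_nonpos_of_nonneg_of_nonpos (Real.rpow_nonneg ht0.le _)
        have := hm (Set.mem_Ioi.2 one_pos) (Set.mem_Ioi.2 ht0) ht.1
        simp only at this
        rw [hone] at this
        linarith
    exact this ⟨le_rfl, h1⟩ ⟨h1, le_rfl⟩ h1

end Ctx

/-- The Nehari set, in normalized form. -/
def MM (V R : Z d → Z d → ℝ) (h : Z d → ℝ) (p : ℝ) (f : ℝ → ℝ) : Set (Z d → ℝ) :=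
  {u | memH V h p u ∧ u ≠ 0 ∧ HnormP V h p u = AA R f u}

namespace Ctx

variable {V R : Z d → Z d → ℝ} {R0 : ℝ} {h : Z d → ℝ} {h₀ p : ℝ} {f : ℝ → ℝ} {θ : ℝ}
  {u : Z d → ℝ}

lemma MM_pos (H : Ctx V R R0 h h₀ p f θ) (hu : u ∈ MM V R h p f) : pos u ≠ 0 := by
  intro hc
  have h1 := VOK.HnormP_pos H.h hu.1 hu.2.1
  rw [hu.2.2, AA_zero_of_pos hc] at h1
  exact lt_irrefl _ h1

lemma MM_coer (H : Ctx V R R0 h h₀ p f θ) (hu : u ∈ MM V R h p f) :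
    (1 / p - 1 / θ) * HnormP V h p u ≤ JJ V R h p f u := by
  have h1 := H.DD_le hu.1
  have hθ : 0 < θ := by linarith [H.f.lt, H.h.p_pos]
  rw [← hu.2.2] at h1
  unfold JJ
  have : (1 / 2) * DD R f u ≤ 1 / θ * HnormP V h p u := by
    rw [div_mul_eq_mul_div, div_mul_eq_mul_div, div_le_div_iff₀ (by norm_num) hθ]
    linarith
  linarith

lemma coef_pos (H : Ctx V R R0 h h₀ p f θ) : 0 < 1 / p - 1 / θ :=
  sub_pos.2 (one_div_lt_one_div_of_lt H.h.p_pos H.f.lt)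

lemma JJ_nonneg (H : Ctx V R R0 h h₀ p f θ) (hu : u ∈ MM V R h p f) :
    0 ≤ JJ V R h p f u :=
  (mul_nonneg H.coef_pos.le (VOK.HnormP_nonneg H.h u)).trans (H.MM_coer hu)

lemma MM_lower (H : Ctx V R R0 h h₀ p f θ) :
    ∃ ρ : ℝ, 0 < ρ ∧ ∀ u ∈ MM V R h p f, ρ ≤ HnormP V h p u := by
  obtain ⟨C, hC, hA⟩ := H.AA_le
  refine ⟨min 1 (1 / C), lt_min one_pos (by positivity), fun u hu => ?_⟩
  rcases le_or_gt (HnormP V h p u) 1 with h1 | h1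
  · refine (min_le_right _ _).trans ?_
    have h2 := hA u hu.1 h1
    rw [← hu.2.2] at h2
    have h3 := VOK.HnormP_pos H.h hu.1 hu.2.1
    rw [div_le_iff₀ hC]
    nlinarith
  · exact (min_le_left _ _).trans h1.le

lemma MM_scale (H : Ctx V R R0 h h₀ p f θ) (hu : memH V h p u) (hp0 : pos u ≠ 0) :
    ∃ t : ℝ, 0 < t ∧ (fun x => t * u x) ∈ MM V R h p f := by
  obtain ⟨t, ht, he⟩ := H.exists_scale hu hp0
  exact ⟨t, ht, VOK.mem_smul ht.le hu, ne_zero_of_pos (pos_scale ht hp0), he⟩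

lemma MM_nonempty (H : Ctx V R R0 h h₀ p f θ) : (MM V R h p f).Nonempty := by
  obtain ⟨t, _, ht⟩ := H.MM_scale (H.v.mem_dlt H.h H.f.two_le 0) (by
    intro hc
    have := congrFun hc 0
    simp [pos, VOK.dlt] at this)
  exact ⟨_, ht⟩

lemma bddBelow (H : Ctx V R R0 h h₀ p f θ) : BddBelow (JJ V R h p f '' MM V R h p f) :=
  ⟨0, by rintro _ ⟨u, hu, rfl⟩; exact H.JJ_nonneg hu⟩

lemma pos_pos_scale {t : ℝ} (ht : 0 < t) (a : ℝ) : max (t * max a 0) 0 = max (t * a) 0 := by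
  rw [max_eq_left (mul_nonneg ht.le (le_max_right _ _)), mul_max_of_nonneg _ _ ht.le, mul_zero]

/-- Existence of a nonnegative minimizer. -/
theorem exists_min (H : Ctx V R R0 h h₀ p f θ) (H4 : Mono4 V R h p f) :
    ∃ u ∈ MM V R h p f, (∀ x, 0 ≤ u x) ∧
      JJ V R h p f u = sInf (JJ V R h p f '' MM V R h p f) := by
  set c := sInf (JJ V R h p f '' MM V R h p f) with hc
  have hp := H.h.p_pos
  have hpθ := H.coef_pos
  obtain ⟨j, -, hjt, hjm⟩ := exists_seq_tendsto_sInf (H.MM_nonempty.image (JJ V R h p f)) H.bddBelow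
  choose un hun hunj using hjm
  have hJ : Tendsto (fun n => JJ V R h p f (un n)) atTop (𝓝 c) := by
    simpa only [hunj] using hjt
  obtain ⟨B, hB⟩ := hJ.bddAbove_range
  have hN : ∀ n, HnormP V h p (un n) ≤ B / (1 / p - 1 / θ) := fun n => by
    rw [le_div_iff₀ hpθ]
    have h1 := H.MM_coer (hun n)
    have h2 := hB ⟨n, rfl⟩
    simp only at h2
    linarith
  set K := B / (1 / p - 1 / θ) with hK
  set m := (K / h₀) ^ (1 / p) with hm
  have hbd : ∀ n x, |un n x| ≤ m := fun n =>
    H.h.abs_le (VOK.mem_h H.h (hun n).1) ((VOK.hsum_le H.h (hun n).1).trans (hN n))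
  have hcpt : IsCompact (Set.univ.pi fun _ : Z d => Set.Icc (-m) m) :=
    isCompact_univ_pi fun _ => isCompact_Icc
  obtain ⟨w, -, φ, hφ, hw⟩ := hcpt.tendsto_subseq (x := un)
    (fun n x _ => abs_le.1 (hbd n x))
  have hlim : ∀ x, Tendsto (fun n => un (φ n) x) atTop (𝓝 (w x)) := fun x =>
    (tendsto_pi_nhds.1 hw) x
  have hmem : ∀ᶠ n in atTop, memH V h p (un (φ n)) := Eventually.of_forall fun n => (hun _).1
  have hKK : ∀ᶠ n in atTop, HnormP V h p (un (φ n)) ≤ K := Eventually.of_forall fun n => hN _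
  have hwm := (H.v.fatou H.h hmem hKK hlim).1
  obtain ⟨ρ, hρ, hρM⟩ := H.MM_lower
  have hAw : ρ ≤ AA R f w := by
    refine ge_of_tendsto (H.tendsto_AA hwm hmem hKK hlim) (Eventually.of_forall fun n => ?_)
    rw [← (hun (φ n)).2.2]
    exact hρM _ (hun _)
  have hpw : pos w ≠ 0 := by
    intro h0
    rw [AA_zero_of_pos h0] at hAw
    linarith
  obtain ⟨x0, hx0⟩ := exists_pos_of_pos hpw
  have hcomp := H.v.mem_of_le H.h (v := pos w) hwm
    (fun x y => abs_max_sub_max_le_abs (w x) (w y) 0) (fun x => by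
      unfold pos
      rcases le_total (w x) 0 with h0 | h0
      · rw [max_eq_right h0]; simp
      · rw [max_eq_left h0])
  obtain ⟨t, ht, htM⟩ := H.MM_scale hcomp.1 (by
    intro h0
    have := congrFun h0 x0
    simp only [pos, Pi.zero_apply] at this
    have h2 := le_max_left (max (w x0) 0) 0
    have h3 := le_max_left (w x0) 0
    linarith)
  refine ⟨_, htM, fun x => mul_nonneg ht.le (le_max_right _ _), le_antisymm ?_
    (csInf_le H.bddBelow ⟨_, htM, rfl⟩)⟩
  -- compare with `t * w`
  have hDD : DD R f (fun x => t * pos w x) = DD R f (fun x => t * w x) := by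
    unfold DD Phi pos
    simp only [pos_pos_scale ht]
  have hHn : HnormP V h p (fun x => t * pos w x) ≤ HnormP V h p (fun x => t * w x) := by
    rw [VOK.HnormP_smul ht.le, VOK.HnormP_smul ht.le]
    exact mul_le_mul_of_nonneg_left hcomp.2 (Real.rpow_nonneg ht.le _)
  have hmem' : ∀ᶠ n in atTop, memH V h p (fun x => t * un (φ n) x) :=
    Eventually.of_forall fun n => VOK.mem_smul ht.le (hun _).1
  have hK' : ∀ᶠ n in atTop, HnormP V h p (fun x => t * un (φ n) x) ≤ t ^ p * K :=
    Eventually.of_forall fun n => by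
      rw [VOK.HnormP_smul ht.le]
      exact mul_le_mul_of_nonneg_left (hN _) (Real.rpow_nonneg ht.le _)
  have hlim' : ∀ x, Tendsto (fun n => t * un (φ n) x) atTop (𝓝 (t * w x)) := fun x =>
    (hlim x).const_mul t
  have hDlim := H.tendsto_DD (VOK.mem_smul ht.le hwm) hmem' hK' hlim'
  have hJ' := hJ.comp hφ.tendsto_atTop
  refine le_of_forall_pos_le_add fun ε hε => ?_
  have hev : ∀ᶠ n in atTop, HnormP V h p (fun x => t * un (φ n) x) ≤
      p * (c + ε / 2 + (1 / 2) * (DD R f (fun x => t * w x) + ε)) := by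
    filter_upwards [hJ'.eventually_lt_const (by linarith : c < c + ε / 2),
      hDlim.eventually_lt_const (by linarith :
        DD R f (fun x => t * w x) < DD R f (fun x => t * w x) + ε)] with n h1 h2
    have h3 := H.fiber_max H4 (hun (φ n)).1 (H.MM_pos (hun _)) (hun (φ n)).2.2 ht
    have h4 : JJ V R h p f (fun x => t * un (φ n) x) < c + ε / 2 := h3.trans_lt h1
    unfold JJ at h4
    have h5 : (1 / p) * HnormP V h p (fun x => t * un (φ n) x) ≤
      c + ε / 2 + (1 / 2) * (DD R f (fun x => t * w x) + ε) := by linarith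
    rw [div_mul_eq_mul_div, one_mul, div_le_iff₀ hp] at h5
    linarith
  have hF := (H.v.fatou H.h hmem' hev hlim').2
  unfold JJ
  rw [hDD]
  have : (1 / p) * HnormP V h p (fun x => t * pos w x) ≤
      c + ε / 2 + (1 / 2) * (DD R f (fun x => t * w x) + ε) := by
    rw [div_mul_eq_mul_div, one_mul, div_le_iff₀ hp]
    linarith
  linarith

end Ctx

namespace VOK

variable {V : Z d → Z d → ℝ} {h : Z d → ℝ} {h₀ p : ℝ} {u v : Z d → ℝ}

lemma exists_EE_bound (H : VOK V) (Hh : HOK h h₀ p) (hu : memH V h p u) :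
    ∃ B, 0 ≤ B ∧ ∀ z, EE V u z ≤ B := by
  have hp := Hh.p_pos
  have hs := mem_g Hh hu
  refine ⟨(∑' x, gradNorm V u x ^ p) ^ (2 / p),
    Real.rpow_nonneg (tsum_nonneg fun x => gp_nonneg u x p) _, fun z => ?_⟩
  have h1 : EE V u z ^ (p / 2) ≤ ∑' x, gradNorm V u x ^ p := by
    rw [← H.gradNorm_rpow]
    exact hs.le_tsum z fun y _ => gp_nonneg u y p
  have h0 := H.EE_nonneg u z
  calc EE V u z = (EE V u z ^ (p / 2)) ^ (2 / p) := by
        rw [← Real.rpow_mul h0, show p / 2 * (2 / p) = 1 by field_simp, Real.rpow_one]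
    _ ≤ _ := Real.rpow_le_rpow (Real.rpow_nonneg h0 _) h1 (by positivity)

lemma summable_lin (H : VOK V) {m : ℝ} (hm : ∀ x, |u x| ≤ m) (x : Z d) :
    Summable fun y => V x y * (u x - u y) := by
  refine Summable.of_norm_bounded ((H.sum x).mul_right (2 * m)) fun y => ?_
  rw [Real.norm_eq_abs, abs_mul, abs_of_nonneg (H.nonneg x y)]
  refine mul_le_mul_of_nonneg_left ?_ (H.nonneg x y)
  have := abs_sub (u x) (u y)
  linarith [hm x, hm y]

lemma mem_pert (H : VOK V) (Hh : HOK h h₀ p) (hp : 2 ≤ p) (hu : memH V h p u) (x : Z d) (ε : ℝ) :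
    memH V h p (fun y => u y + ε * dlt x y) := by
  refine H.mem_add Hh hu ?_
  refine (H.mem_of_le Hh (mem_smul (abs_nonneg ε) (H.mem_dlt Hh hp x)) (fun y z => ?_)
    (fun y => ?_)).1
  · rw [← mul_sub, ← mul_sub, abs_mul, abs_mul, abs_abs]
  · rw [abs_mul, abs_mul, abs_abs]

/-- `EE` of `u + ε δ_x`. -/
lemma EE_pert (H : VOK V) (hu : ∀ z, Summable fun y => V z y * (u z - u y) ^ 2) {m : ℝ}
    (hm : ∀ x, |u x| ≤ m) (x z : Z d) (ε : ℝ) :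
    EE V (fun y => u y + ε * dlt x y) z = EE V u z +
      ε * (V x z * (u x - u z) + if z = x then ∑' y, V x y * (u x - u y) else 0) +
      ε ^ 2 * ((1 / 2) * V x z + if z = x then (1 / 2) * ∑' y, V x y else 0) := by
  unfold EE
  by_cases hz : z = x
  · subst hz
    have e : ∀ y, V z y * ((u z + ε * dlt z z) - (u y + ε * dlt z y)) ^ 2 =
        V z y * (u z - u y) ^ 2 + (2 * ε * (V z y * (u z - u y)) + ε ^ 2 * V z y) := by
      intro y
      by_cases hy : y = z
      · subst hy; simp [H.diag]
      · simp only [dlt, hy, if_true, if_false]; ring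
    rw [tsum_congr e, (hu z).tsum_add (((H.summable_lin hm z).mul_left _).add
      ((H.sum z).mul_left _)), ((H.summable_lin hm z).mul_left _).tsum_add
      ((H.sum z).mul_left _), tsum_mul_left, tsum_mul_left]
    simp only [if_true, H.diag]
    ring
  · have e : ∀ y, V z y * ((u z + ε * dlt x z) - (u y + ε * dlt x y)) ^ 2 =
        V z y * (u z - u y) ^ 2 +
          (if y = x then V z x * (-2 * ε * (u z - u x) + ε ^ 2) else 0) := by
      intro y
      by_cases hy : y = x
      · subst hy; simp only [dlt, hz, if_true, if_false]; ring
      · simp only [dlt, hy, hz, if_false]; ring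
    rw [tsum_congr e, (hu z).tsum_add (hasSum_ite_eq x _).summable, tsum_ite_eq]
    simp only [hz, if_false, H.symm z x]
    ring

lemma summable_pLap (H : VOK V) (Hh : HOK h h₀ p) (hp : 2 ≤ p) (hu : memH V h p u) (x : Z d) :
    (Summable fun y => V x y * gradNorm V u y ^ (p - 2) * (u x - u y)) ∧
    Summable fun y => V x y * (gradNorm V u x ^ (p - 2) + gradNorm V u y ^ (p - 2)) *
      (u x - u y) := by
  obtain ⟨m, hm⟩ : ∃ m, ∀ x, |u x| ≤ m := ⟨_, Hh.abs_le (mem_h Hh hu) le_rfl⟩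
  obtain ⟨B, hB0, hB⟩ := H.exists_EE_bound Hh hu
  have h1 := H.summable_lin hm x
  have h2 : Summable fun y => V x y * gradNorm V u y ^ (p - 2) * (u x - u y) := by
    refine Summable.of_norm_bounded (h1.norm.mul_right (B ^ ((p - 2) / 2))) fun y => ?_
    rw [mul_right_comm, norm_mul]
    refine mul_le_mul_of_nonneg_left ?_ (norm_nonneg _)
    rw [Real.norm_eq_abs, abs_of_nonneg (gp_nonneg _ _ _), H.gradNorm_rpow]
    exact Real.rpow_le_rpow (H.EE_nonneg _ _) (hB y) (by linarith)
  refine ⟨h2, ((h1.mul_left (gradNorm V u x ^ (p - 2))).add h2).congr fun y => by ring⟩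

lemma hasDerivAt_HnormP (H : VOK V) (Hh : HOK h h₀ p) (hp : 2 ≤ p) (hu : memH V h p u) (x : Z d) :
    HasDerivAt (fun ε : ℝ => HnormP V h p (fun y => u y + ε * dlt x y))
      (p * (pLap V p u x + h x * (|u x| ^ (p - 2) * u x))) 0 := by
  obtain ⟨m, hm⟩ : ∃ m, ∀ x, |u x| ≤ m := ⟨_, Hh.abs_le (mem_h Hh hu) le_rfl⟩
  have hm0 : 0 ≤ m := (abs_nonneg _).trans (hm 0)
  obtain ⟨B, hB0, hB⟩ := H.exists_EE_bound Hh hu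
  set bX := ∑' y, V x y * (u x - u y) with hbX
  set cX := (1 / 2) * ∑' y, V x y with hcX
  have hcX0 : 0 ≤ cX := mul_nonneg (by norm_num) (tsum_nonneg fun y => H.nonneg x y)
  set b : Z d → ℝ := fun z => V x z * (u x - u z) + if z = x then bX else 0 with hb
  set c : Z d → ℝ := fun z => (1 / 2) * V x z + if z = x then cX else 0 with hc
  have hc0 : ∀ z, 0 ≤ c z := fun z => by
    simp only [hc]
    have := H.nonneg x z
    split_ifs <;> linarith
  have hEE : ∀ z ε, EE V (fun y => u y + ε * dlt x y) z = EE V u z + ε * b z + ε ^ 2 * c z :=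
    fun z ε => H.EE_pert hu.1 hm x z ε
  have hbs : Summable b := (H.summable_lin hm x).add (hasSum_ite_eq x _).summable
  have hcs : Summable c := ((H.sum x).mul_left _).add (hasSum_ite_eq x _).summable
  set D : Z d → ℝ := fun z => |b z| + 2 * c z with hD
  have hDs : Summable D := hbs.abs.add (hcs.mul_left 2)
  have hD0 : ∀ z, 0 ≤ D z := fun z => by have := hc0 z; positivity
  set S := ∑' z, D z with hS
  have hDS : ∀ z, D z ≤ S := fun z => hDs.le_tsum z fun y _ => hD0 y
  have hS0 : 0 ≤ S := (hD0 0).trans (hDS 0)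
  have hEle : ∀ z, ∀ ε ∈ Set.Ioo (-1 : ℝ) 1, EE V (fun y => u y + ε * dlt x y) z ≤ B + S := by
    intro z ε hε
    rw [hEE]
    have h1 : ε * b z ≤ |b z| := by
      refine (le_abs_self _).trans ?_
      rw [abs_mul]
      exact mul_le_of_le_one_left (abs_nonneg _) (abs_le.2 ⟨hε.1.le, hε.2.le⟩)
    have h2 : ε ^ 2 * c z ≤ c z := mul_le_of_le_one_left (hc0 z) (by nlinarith [hε.1, hε.2])
    have := hB z
    have h3 := hDS z
    simp only [hD] at h3
    linarith [hc0 z]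
  -- termwise derivative
  have hterm : ∀ z ε, HasDerivAt (fun ε : ℝ => EE V (fun y => u y + ε * dlt x y) z ^ (p / 2))
      ((b z + 2 * ε * c z) * (p / 2) * EE V (fun y => u y + ε * dlt x y) z ^ (p / 2 - 1)) ε := by
    intro z ε
    simp only [hEE]
    have h1 : HasDerivAt (fun ε : ℝ => EE V u z + ε * b z + ε ^ 2 * c z)
        (b z + 2 * ε * c z) ε := by
      have h2 := (((hasDerivAt_id ε).mul_const (b z)).const_add (EE V u z)).add
        ((hasDerivAt_pow 2 ε).mul_const (c z))
      convert! h2 using 1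
      simp
    exact h1.rpow_const (Or.inr (by linarith))
  have hgrad : HasDerivAt (fun ε : ℝ => ∑' z, EE V (fun y => u y + ε * dlt x y) z ^ (p / 2))
      (∑' z, (b z + 2 * 0 * c z) * (p / 2) *
        EE V (fun y => u y + 0 * dlt x y) z ^ (p / 2 - 1)) 0 := by
    refine hasDerivAt_tsum_of_isPreconnected (u := fun z => D z * (p / 2 * (B + S) ^ (p / 2 - 1)))
      (t := Set.Ioo (-1) 1) (y₀ := 0) (hDs.mul_right _) isOpen_Ioo
      (convex_Ioo _ _).isPreconnected (fun z ε _ => hterm z ε) (fun z ε hε => ?_)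
      (by simp) ?_ (by simp)
    · rw [Real.norm_eq_abs, mul_assoc, abs_mul]
      have h1 : |b z + 2 * ε * c z| ≤ D z := by
        refine (abs_add_le _ _).trans ?_
        have : |2 * ε * c z| ≤ 2 * c z := by
          rw [abs_mul, abs_of_nonneg (hc0 z), abs_mul, abs_two]
          have : |ε| ≤ 1 := abs_le.2 ⟨hε.1.le, hε.2.le⟩
          nlinarith [hc0 z]
        simp only [hD]; linarith
      have h2 : 0 ≤ p / 2 * EE V (fun y => u y + ε * dlt x y) z ^ (p / 2 - 1) :=
        mul_nonneg (by linarith) (Real.rpow_nonneg (H.EE_nonneg _ _) _)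
      rw [abs_of_nonneg h2]
      refine mul_le_mul h1 (mul_le_mul_of_nonneg_left ?_ (by linarith)) h2 (hD0 z)
      exact Real.rpow_le_rpow (H.EE_nonneg _ _) (hEle z ε hε) (by linarith)
    · refine (mem_g Hh hu).congr fun z => ?_
      rw [H.gradNorm_rpow]; simp
  have hpot : HasDerivAt (fun ε : ℝ => ∑' z, h z * |u z + ε * dlt x z| ^ p)
      (h x * (p * |u x| ^ (p - 2) * u x)) 0 := by
    have e : ∀ ε : ℝ, ∑' z, h z * |u z + ε * dlt x z| ^ p =
        (∑' z, h z * |u z| ^ p) + (h x * |ε + u x| ^ p - h x * |u x| ^ p) := by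
      intro ε
      have e1 : ∀ z, h z * |u z + ε * dlt x z| ^ p = h z * |u z| ^ p +
          (if z = x then (h x * |ε + u x| ^ p - h x * |u x| ^ p) else 0) := by
        intro z
        by_cases hz : z = x
        · subst hz; simp [dlt, add_comm]
        · simp [dlt, hz]
      rw [tsum_congr e1, (mem_h Hh hu).tsum_add (hasSum_ite_eq x _).summable, tsum_ite_eq]
    simp only [e]
    have h1 := hasDerivAt_abs_rpow (0 + u x) (by linarith : 1 < p)
    have h2 := (h1.comp_add_const (0 : ℝ) (u x))
    rw [zero_add] at h2
    exact ((h2.const_mul (h x)).sub_const _).const_add _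
  have hsum := hgrad.add hpot
  have heq : ∀ᶠ ε : ℝ in 𝓝 0, HnormP V h p (fun y => u y + ε * dlt x y) =
      (∑' z, EE V (fun y => u y + ε * dlt x y) z ^ (p / 2)) +
        ∑' z, h z * |u z + ε * dlt x z| ^ p := by
    refine Eventually.of_forall fun ε => ?_
    have hmem := H.mem_pert Hh hp hu x ε
    unfold HnormP
    rw [(mem_g Hh hmem).tsum_add (mem_h Hh hmem)]
    simp only [H.gradNorm_rpow]
  refine (hsum.congr_of_eventuallyEq heq).congr_deriv ?_
  have e1 : ∀ z, (b z + 2 * 0 * c z) * (p / 2) *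
        EE V (fun y => u y + 0 * dlt x y) z ^ (p / 2 - 1) =
      p / 2 * (V x z * gradNorm V u z ^ (p - 2) * (u x - u z) +
        if z = x then bX * gradNorm V u x ^ (p - 2) else 0) := by
    intro z
    simp only [zero_mul, add_zero, mul_zero]
    rw [H.gradNorm_rpow, H.gradNorm_rpow, show (p - 2) / 2 = p / 2 - 1 by ring]
    simp only [hb]
    split_ifs with hz
    · subst hz; ring
    · ring
  obtain ⟨s1, s2⟩ := H.summable_pLap Hh hp hu x
  rw [tsum_congr e1, tsum_mul_left, s1.tsum_add (hasSum_ite_eq x _).summable, tsum_ite_eq]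
  unfold pLap
  have e2 : ∀ y, V x y * (gradNorm V u x ^ (p - 2) + gradNorm V u y ^ (p - 2)) * (u x - u y) =
      gradNorm V u x ^ (p - 2) * (V x y * (u x - u y)) +
        V x y * gradNorm V u y ^ (p - 2) * (u x - u y) := fun y => by ring
  rw [tsum_congr e2, ((H.summable_lin hm x).mul_left _).tsum_add s1, tsum_mul_left]
  ring

end VOK

namespace Ctx

variable {V R : Z d → Z d → ℝ} {R0 : ℝ} {h : Z d → ℝ} {h₀ p : ℝ} {f : ℝ → ℝ} {θ : ℝ}
  {u : Z d → ℝ}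

open VOK in
lemma exists_T (H : Ctx V R R0 h h₀ p f θ) (H4 : Mono4 V R h p f) (hu : u ∈ MM V R h p f)
    (x : Z d) :
    ∃ T : ℝ → ℝ, Tendsto T (𝓝 0) (𝓝 1) ∧
      ∀ᶠ ε in 𝓝 (0:ℝ), 0 < T ε ∧ (fun y => T ε * (u y + ε * dlt x y)) ∈ MM V R h p f := by
  have hp := H.h.p_pos
  have hmem : ∀ ε : ℝ, memH V h p (fun y => u y + ε * dlt x y) := fun ε =>
    H.v.mem_pert H.h H.f.two_le hu.1 x ε
  have hlim : ∀ y, Tendsto (fun ε : ℝ => u y + ε * dlt x y) (𝓝 0) (𝓝 (u y)) := fun y => by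
    have : Continuous (fun ε : ℝ => u y + ε * dlt x y) := by fun_prop
    simpa using this.tendsto 0
  obtain ⟨x0, hx0⟩ := exists_pos_of_pos (H.MM_pos hu)
  have hpos : ∀ᶠ ε in 𝓝 (0:ℝ), pos (fun y => u y + ε * dlt x y) ≠ 0 := by
    filter_upwards [(hlim x0).eventually_const_lt hx0] with ε hε hc
    have := congrFun hc x0
    simp only [pos, Pi.zero_apply] at this
    rw [max_eq_left hε.le] at this
    linarith
  have hn : Tendsto (fun ε : ℝ => HnormP V h p (fun y => u y + ε * dlt x y)) (𝓝 0)
      (𝓝 (HnormP V h p u)) := by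
    have := (H.v.hasDerivAt_HnormP H.h H.f.two_le hu.1 x).continuousAt
    simpa [ContinuousAt] using this
  have hAA : ∀ s : ℝ, 0 < s → Tendsto (fun ε : ℝ => AA R f (fun y => s * (u y + ε * dlt x y)))
      (𝓝 0) (𝓝 (AA R f (fun y => s * u y))) := by
    intro s hs
    refine H.tendsto_AA (K := s ^ p * (HnormP V h p u + 1)) (VOK.mem_smul hs.le hu.1)
      (Eventually.of_forall fun ε => VOK.mem_smul hs.le (hmem ε)) ?_
      (fun y => (hlim y).const_mul s)
    filter_upwards [hn.eventually_lt_const (lt_add_one _)] with ε hε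
    rw [VOK.HnormP_smul hs.le]
    exact mul_le_mul_of_nonneg_left hε.le (Real.rpow_nonneg hs.le _)
  have hex : ∀ ε : ℝ, ∃ t : ℝ, pos (fun y => u y + ε * dlt x y) ≠ 0 → 0 < t ∧
      (fun y => t * (u y + ε * dlt x y)) ∈ MM V R h p f := by
    intro ε
    by_cases h0 : pos (fun y => u y + ε * dlt x y) ≠ 0
    · obtain ⟨t, h1, h2⟩ := H.MM_scale (hmem ε) h0
      exact ⟨t, fun _ => ⟨h1, h2⟩⟩
    · exact ⟨0, fun h1 => absurd h1 h0⟩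
  choose T hT using hex
  refine ⟨T, ?_, hpos.mono fun ε hε => hT ε hε⟩
  have hval : ∀ ε, pos (fun y => u y + ε * dlt x y) ≠ 0 →
      T ε ^ (-p) * AA R f (fun y => T ε * (u y + ε * dlt x y)) =
        HnormP V h p (fun y => u y + ε * dlt x y) := by
    intro ε hε
    obtain ⟨h1, h2⟩ := hT ε hε
    rw [← h2.2.2, VOK.HnormP_smul h1.le, ← mul_assoc, ← Real.rpow_add h1]
    simp
  have hone : (1:ℝ) ^ (-p) * AA R f (fun x => 1 * u x) = HnormP V h p u := by
    simp [hu.2.2]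
  have hmono := H4 u hu.1 (H.MM_pos hu)
  rw [tendsto_order]
  constructor
  · intro a ha
    set s := max a (1 / 2) with hs
    have hs0 : 0 < s := lt_max_of_lt_right (by norm_num)
    have hs1 : s < 1 := max_lt ha (by norm_num)
    have hlt := hmono (Set.mem_Ioi.2 hs0) (Set.mem_Ioi.2 one_pos) hs1
    simp only at hlt
    rw [hone] at hlt
    filter_upwards [hpos, ((hAA s hs0).const_mul (s ^ (-p))).eventually_lt hn hlt] with ε h1 h2
    rw [← hval ε h1] at h2
    have := (H4 _ (hmem ε) h1).lt_iff_lt (Set.mem_Ioi.2 hs0) (Set.mem_Ioi.2 (hT ε h1).1)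
    exact (le_max_left _ _).trans_lt (this.1 h2)
  · intro s hs1
    have hs0 : 0 < s := one_pos.trans hs1
    have hlt := hmono (Set.mem_Ioi.2 one_pos) (Set.mem_Ioi.2 hs0) hs1
    simp only at hlt
    rw [hone] at hlt
    filter_upwards [hpos, hn.eventually_lt ((hAA s hs0).const_mul (s ^ (-p))) hlt] with ε h1 h2
    rw [← hval ε h1] at h2
    have := (H4 _ (hmem ε) h1).lt_iff_lt (Set.mem_Ioi.2 (hT ε h1).1) (Set.mem_Ioi.2 hs0)
    exact this.1 h2

lemma Phi_eq (H : Ctx V R R0 h h₀ p f θ) (t : ℝ) : Phi f t = Fint f t := by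
  unfold Phi
  rcases le_total t 0 with ht | ht
  · rw [max_eq_right ht]
    unfold Fint
    rw [intervalIntegral.integral_same, intervalIntegral.integral_symm]
    have : ∫ r in t..0, f r = ∫ r in t..0, (0:ℝ) := by
      refine intervalIntegral.integral_congr fun r hr => ?_
      rw [Set.uIcc_of_le ht] at hr
      exact H.f.zero r hr.2
    simp [this]
  · rw [max_eq_left ht]

lemma Phi_strict (H : Ctx V R R0 h h₀ p f θ) (t : ℝ) : HasStrictDerivAt (Phi f) (f t) t := by
  have : Phi f = Fint f := funext H.Phi_eq
  rw [this]
  exact intervalIntegral.integral_hasStrictDerivAt_right (H.f.cont.intervalIntegrable _ _)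
    (H.f.cont.stronglyMeasurableAtFilter _ _) H.f.cont.continuousAt

open VOK in
lemma DD_pert (H : Ctx V R R0 h h₀ p f θ) (hu : memH V h p u) (x : Z d) {t : ℝ} (ht : 0 ≤ t)
    (ε : ℝ) :
    DD R f (fun y => t * (u y + ε * dlt x y)) = DD R f (fun y => t * u y) +
      (2 * (Phi f (t * (u x + ε)) - Phi f (t * u x)) * cv R (fun y => Phi f (t * u y)) x +
        (Phi f (t * (u x + ε)) - Phi f (t * u x)) ^ 2 * R x x) := by
  set a := Phi f (t * (u x + ε)) - Phi f (t * u x) with ha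
  have e : ∀ y, Phi f (t * (u y + ε * dlt x y)) = Phi f (t * u y) + a * dlt x y := by
    intro y
    by_cases hy : y = x
    · subst hy; simp [dlt, ha]
    · simp [dlt, hy]
  have sA := H.sPhi (VOK.mem_smul ht hu)
  have sd : Summable fun y => |a * dlt x y| := by
    refine (hasSum_ite_eq x |a|).summable.congr fun y => ?_
    by_cases hy : y = x <;> simp [dlt, hy]
  have hright : ∀ b : Z d → ℝ, bil R b (fun y => a * dlt x y) = a * cv R b x := by
    intro b
    rw [ROK.bil_mul_right]
    congr 1
    unfold bil
    rw [tsum_eq_single x (fun y hy => by simp [dlt, hy])]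
    simp [dlt]
  have hdd : cv R (fun y => a * dlt x y) x = a * R x x := by
    unfold cv
    rw [tsum_eq_single x (fun y hy => by simp [dlt, hy])]
    simp [dlt, mul_comm]
  have sAd := ROK.summable_abs_add sA sd
  unfold DD
  simp only [e]
  rw [H.r.bil_add_left sA sd sAd, H.r.bil_symm sA sAd, H.r.bil_add_left sA sd sA,
    H.r.bil_symm sd sA, H.r.bil_symm sd sAd, H.r.bil_add_left sA sd sd, hright, hright, hdd]
  ring

open VOK in
theorem euler_lagrange (H : Ctx V R R0 h h₀ p f θ) (H4 : Mono4 V R h p f)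
    (hu : u ∈ MM V R h p f) (hu0 : ∀ x, 0 ≤ u x)
    (hmin : ∀ w ∈ MM V R h p f, JJ V R h p f u ≤ JJ V R h p f w) (x : Z d) :
    pLap V p u x + h x * u x ^ (p - 1) = cv R (fun y => Phi f (u y)) x * f (u x) := by
  have hp := H.h.p_pos
  have hp2 := H.f.two_le
  obtain ⟨T, hT1, hT⟩ := H.exists_T H4 hu x
  have hle : 𝓝[≠] (0:ℝ) ≤ 𝓝 0 := nhdsWithin_le_nhds
  set n : ℝ → ℝ := fun ε => HnormP V h p (fun y => u y + ε * dlt x y) with hn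
  have hnd : HasDerivAt n _ 0 := H.v.hasDerivAt_HnormP H.h hp2 hu.1 x
  have hslope := hasDerivAt_iff_tendsto_slope.1 hnd
  set L' := pLap V p u x + h x * (|u x| ^ (p - 2) * u x) with hL'
  set a : ℝ → ℝ := fun ε => Phi f (T ε * (u x + ε)) - Phi f (T ε * u x) with ha
  set g : ℝ → ℝ := fun ε => cv R (fun y => Phi f (T ε * u y)) x with hg
  have hTn := hT1.mono_left hle
  have hid : Tendsto (fun ε : ℝ => ε) (𝓝[≠] 0) (𝓝 0) := hle
  -- limit of `a ε / ε`
  have hpair : Tendsto (fun ε : ℝ => (T ε * (u x + ε), T ε * u x)) (𝓝[≠] 0)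
      (𝓝 (u x, u x)) := by
    refine Tendsto.prodMk_nhds ?_ ?_
    · simpa using hTn.mul (tendsto_const_nhds.add hid)
    · simpa using hTn.mul_const (u x)
  have hlo := ((H.Phi_strict (u x)).hasStrictFDerivAt.isLittleO).comp_tendsto hpair
  have hadiv : Tendsto (fun ε => a ε / ε) (𝓝[≠] 0) (𝓝 (f (u x))) := by
    have h1 := hlo.tendsto_div_nhds_zero
    have h2 := (h1.add_const (f (u x))).mul hTn
    rw [zero_add, mul_one] at h2
    refine h2.congr' ?_
    filter_upwards [hT.filter_mono hle, self_mem_nhdsWithin] with ε h3 h4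
    have h5 : T ε ≠ 0 := h3.1.ne'
    have h6 : ε ≠ 0 := h4
    simp only [Function.comp, ha, ContinuousLinearMap.toSpanSingleton_apply, smul_eq_mul]
    have h7 : T ε * (u x + ε) - T ε * u x = T ε * ε := by ring
    rw [h7]
    field_simp
    ring
  have ha0 : Tendsto a (𝓝[≠] 0) (𝓝 0) := by
    have h1 := hadiv.mul hid
    rw [mul_zero] at h1
    refine h1.congr' ?_
    filter_upwards [self_mem_nhdsWithin] with ε h4
    exact div_mul_cancel₀ _ h4
  have hglim : Tendsto g (𝓝[≠] 0) (𝓝 (cv R (fun y => Phi f (u y)) x)) := by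
    refine H.r.tendsto_cv (H.L1Phi (K := 2 ^ p * HnormP V h p u) (v := fun ε y => T ε * u y)
      hu.1 ?_ ?_ ?_) x
    · filter_upwards [hT.filter_mono hle] with ε h3 using VOK.mem_smul h3.1.le hu.1
    · filter_upwards [hT.filter_mono hle, hTn.eventually_lt_const (by norm_num : (1:ℝ) < 2)]
        with ε h3 h4
      rw [VOK.HnormP_smul h3.1.le]
      exact mul_le_mul_of_nonneg_right (Real.rpow_le_rpow h3.1.le h4.le hp.le)
        (VOK.HnormP_nonneg H.h u)
    · intro y
      simpa using hTn.mul_const (u y)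
  have hTp : Tendsto (fun ε => T ε ^ p) (𝓝[≠] 0) (𝓝 1) := by
    simpa using hTn.rpow_const (p := p) (Or.inl one_ne_zero)
  set Q : ℝ → ℝ := fun ε => (1 / p) * (T ε ^ p * slope n 0 ε) -
    (1 / 2) * (2 * (a ε / ε) * g ε + a ε / ε * a ε * R x x) with hQ
  have hQlim : Tendsto Q (𝓝[≠] 0) (𝓝 (L' - cv R (fun y => Phi f (u y)) x * f (u x))) := by
    have h1 := ((hTp.mul hslope).const_mul (1 / p)).sub
      ((((hadiv.const_mul 2).mul hglim).add ((hadiv.mul ha0).mul_const (R x x))).const_mul (1 / 2))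
    convert! h1 using 2
    field_simp
    ring
  have hQsign : ∀ᶠ ε in 𝓝[≠] (0:ℝ), 0 ≤ ε * Q ε := by
    filter_upwards [hT.filter_mono hle, self_mem_nhdsWithin] with ε h3 h4
    have h6 : ε ≠ 0 := h4
    have h7 := hmin _ h3.2
    have h8 := H.fiber_max H4 hu.1 (H.MM_pos hu) hu.2.2 h3.1
    have h9 := h8.trans h7
    unfold JJ at h9
    rw [H.DD_pert hu.1 x h3.1.le, VOK.HnormP_smul h3.1.le, VOK.HnormP_smul h3.1.le] at h9
    have e0 : HnormP V h p u = n 0 := by simp [hn]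
    have e1 : HnormP V h p (fun y => u y + ε * dlt x y) = n ε := rfl
    rw [e0, e1] at h9
    have e2 : ε * Q ε = (1 / p) * (T ε ^ p * (n ε - n 0)) -
        (1 / 2) * (2 * a ε * g ε + a ε ^ 2 * R x x) := by
      simp only [hQ, slope_def_field, sub_zero]
      field_simp
    rw [e2]
    linarith
  have hR : 0 ≤ L' - cv R (fun y => Phi f (u y)) x * f (u x) := by
    refine ge_of_tendsto (hQlim.mono_left (nhdsWithin_mono 0 (s := Set.Ioi 0)
      (fun y hy => ne_of_gt hy))) ?_
    filter_upwards [hQsign.filter_mono (nhdsWithin_mono 0 (s := Set.Ioi 0)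
      (fun y hy => ne_of_gt hy)), self_mem_nhdsWithin] with ε h1 h2
    exact nonneg_of_mul_nonneg_right h1 h2
  have hL : L' - cv R (fun y => Phi f (u y)) x * f (u x) ≤ 0 := by
    refine le_of_tendsto (hQlim.mono_left (nhdsWithin_mono 0 (s := Set.Iio 0)
      (fun y hy => ne_of_lt hy))) ?_
    filter_upwards [hQsign.filter_mono (nhdsWithin_mono 0 (s := Set.Iio 0)
      (fun y hy => ne_of_lt hy)), self_mem_nhdsWithin] with ε h1 h2
    have h2' : ε < 0 := h2
    by_contra hc
    push Not at hc
    have := mul_neg_of_neg_of_pos h2' hc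
    linarith
  have e : |u x| ^ (p - 2) * u x = u x ^ (p - 1) := by
    rw [abs_of_nonneg (hu0 x)]
    rcases (hu0 x).eq_or_lt with h0 | h0
    · rw [← h0, mul_zero, Real.zero_rpow (by linarith)]
    · rw [← Real.rpow_add_one h0.ne']; congr 1; ring
  rw [hL', e] at hR hL
  linarith

/-- Strong maximum principle. -/
theorem pos_of_solution (H : Ctx V R R0 h h₀ p f θ)
    (hu : u ∈ MM V R h p f) (hu0 : ∀ x, 0 ≤ u x)
    (hEL : ∀ x, pLap V p u x + h x * u x ^ (p - 1) = cv R (fun y => Phi f (u y)) x * f (u x))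
    (x : Z d) : 0 < u x := by
  by_contra hc
  have hx : u x = 0 := le_antisymm (not_lt.1 hc) (hu0 x)
  have h1 := hEL x
  have hp2 := H.f.two_le
  rw [hx, H.f.zero 0 le_rfl, Real.zero_rpow (by linarith), mul_zero, mul_zero, add_zero] at h1
  obtain ⟨y, hy⟩ := exists_pos_of_pos (H.MM_pos hu)
  have hyx : x ≠ y := by rintro rfl; linarith
  have hs := (H.v.summable_pLap H.h hp2 hu.1 x).2
  have hG : 0 < gradNorm V u x := by
    unfold gradNorm
    apply Real.sqrt_pos.2
    have : V x y * (u x - u y) ^ 2 ≤ ∑' y, V x y * (u x - u y) ^ 2 :=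
      (hu.1.1 x).le_tsum y fun z _ => H.v.term_nonneg u x z
    have h3 : 0 < V x y * (u x - u y) ^ 2 := by
      rw [hx]
      have := H.v.pos x y hyx
      have : (0 - u y) ≠ 0 := by intro h; linarith
      positivity
    linarith
  have hneg : pLap V p u x < 0 := by
    unfold pLap
    have h2 : 0 < ∑' z, -(V x z * (gradNorm V u x ^ (p - 2) + gradNorm V u z ^ (p - 2)) *
        (u x - u z)) := by
      refine hs.neg.tsum_pos (fun z => ?_) y ?_
      · rw [hx, zero_sub, mul_neg, neg_neg]
        exact mul_nonneg (mul_nonneg (H.v.nonneg _ _)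
          (add_nonneg (VOK.gp_nonneg _ _ _) (VOK.gp_nonneg _ _ _))) (hu0 z)
      · rw [hx, zero_sub, mul_neg, neg_neg]
        exact mul_pos (mul_pos (H.v.pos x y hyx)
          (add_pos_of_pos_of_nonneg (Real.rpow_pos_of_pos hG _) (VOK.gp_nonneg _ _ _))) hy
    rw [tsum_neg] at h2
    linarith
  linarith

end Ctx

/-- The kernel with its diagonal removed. -/
def Vk (W : Z d → Z d → ℝ) (x y : Z d) : ℝ := if x = y then 0 else W x y

lemma Vk_sq (W : Z d → Z d → ℝ) (u : Z d → ℝ) (x y : Z d) :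
    Vk W x y * (u x - u y) ^ 2 = W x y * (u x - u y) ^ 2 := by
  unfold Vk
  split_ifs with hxy
  · subst hxy; simp
  · rfl

lemma Vk_gradNorm (W : Z d → Z d → ℝ) (u : Z d → ℝ) : gradNorm (Vk W) u = gradNorm W u := by
  funext x
  unfold gradNorm
  rw [tsum_congr fun y => Vk_sq W u x y]

lemma Vk_HnormP (W : Z d → Z d → ℝ) (h : Z d → ℝ) (p : ℝ) (u : Z d → ℝ) :
    HnormP (Vk W) h p u = HnormP W h p u := by
  unfold HnormP
  rw [Vk_gradNorm]

lemma Vk_memH (W : Z d → Z d → ℝ) (h : Z d → ℝ) (p : ℝ) (u : Z d → ℝ) :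
    memH (Vk W) h p u ↔ memH W h p u := by
  unfold memH
  rw [Vk_gradNorm]
  simp only [Vk_sq]

lemma Vk_lin (W : Z d → Z d → ℝ) (g : Z d → ℝ) (u : Z d → ℝ) (x y : Z d) :
    Vk W x y * (g x + g y) * (u x - u y) = W x y * (g x + g y) * (u x - u y) := by
  unfold Vk
  split_ifs with hxy
  · subst hxy; simp
  · rfl

lemma Vk_term (W : Z d → Z d → ℝ) (p : ℝ) (u : Z d → ℝ) (x y : Z d) :
    Vk W x y * (gradNorm (Vk W) u x ^ (p - 2) + gradNorm (Vk W) u y ^ (p - 2)) * (u x - u y) =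
      W x y * (gradNorm W u x ^ (p - 2) + gradNorm W u y ^ (p - 2)) * (u x - u y) := by
  rw [Vk_gradNorm]
  exact Vk_lin W (fun x => gradNorm W u x ^ (p - 2)) u x y

lemma Vk_pLap (W : Z d → Z d → ℝ) (p : ℝ) (u : Z d → ℝ) (x : Z d) :
    pLap (Vk W) p u x = pLap W p u x := by
  unfold pLap
  rw [tsum_congr fun y => Vk_term W p u x y]

lemma norm_le_latDist (x y : Z d) : ‖(fun i => ((y i : ℝ)) - (x i : ℝ))‖ ≤ latDist x y := by
  unfold latDist
  rw [pi_norm_le_iff_of_nonneg (Finset.sum_nonneg fun _ _ => abs_nonneg _)]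
  intro i
  have := Finset.single_le_sum (f := fun i => |((x i - y i : ℤ) : ℝ)|)
    (fun _ _ => abs_nonneg _) (Finset.mem_univ i)
  refine le_trans (le_of_eq ?_) this
  rw [Real.norm_eq_abs, abs_sub_comm]
  push_cast
  rfl

lemma summable_norm_Z (r : ℝ) (hr : r < -(d : ℝ)) (x : Z d) :
    Summable fun y : Z d => ‖(fun i => ((y i : ℝ)) - (x i : ℝ))‖ ^ r := by
  set b := Pi.basisFun ℝ (Fin d) with hb
  set L : Submodule ℤ (Fin d → ℝ) := Submodule.span ℤ (Set.range b) with hL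
  have hrank : Module.finrank ℤ L = d := by
    have h1 := ZLattice.rank ℝ L
    rw [h1]; simp
  have h1 := ZLattice.summable_norm_sub_rpow L r (by rw [hrank]; exact hr) (fun i => (x i : ℝ))
  have hmem : ∀ y : Z d, (fun i => (y i : ℝ)) ∈ L := by
    intro y
    have : (fun i => (y i : ℝ)) = ∑ i, y i • b i := by
      funext j
      simp [hb, Finset.sum_apply, Pi.single_apply]
    rw [this]
    exact Submodule.sum_mem _ fun i _ => Submodule.smul_mem _ _ (Submodule.subset_span ⟨i, rfl⟩)
  have hinj : Function.Injective fun y : Z d => (⟨fun i => (y i : ℝ), hmem y⟩ : L) := by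
    intro y z hyz
    have := congrArg Subtype.val hyz
    funext i
    have h2 : (y i : ℝ) = (z i : ℝ) := congrFun this i
    exact_mod_cast h2
  exact (h1.comp_injective hinj).congr fun y => rfl

lemma Vk_OK {s : ℝ} (hs : 0 < s) {W : Z d → Z d → ℝ} (hW : KernelOK d s W) : VOK (Vk W) := by
  obtain ⟨h1, h2, c, C, hc, hcC, hb⟩ := hW
  have hnn : ∀ x y, 0 ≤ Vk W x y := fun x y => by
    unfold Vk; split_ifs
    · exact le_rfl
    · exact (h2 x y).le
  refine ⟨fun x y => ?_, hnn, fun x => by simp [Vk], fun x y hxy => by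
    simp [Vk, hxy, h2], fun x => ?_⟩
  · unfold Vk
    simp only [eq_comm (a := x) (b := y), h1 x y]
  · have hr : -(d:ℝ) - 2 * s < -(d:ℝ) := by linarith
    refine Summable.of_nonneg_of_le (hnn x) (fun y => ?_)
      ((summable_norm_Z _ hr x).mul_left C)
    unfold Vk
    split_ifs with hxy
    · exact mul_nonneg (hc.le.trans hcC) (Real.rpow_nonneg (norm_nonneg _) _)
    · refine (hb x y hxy).2.trans (mul_le_mul_of_nonneg_left ?_ (hc.le.trans hcC))
      refine Real.rpow_le_rpow_of_nonpos ?_ (norm_le_latDist x y) (by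
        have : (0:ℝ) ≤ d := Nat.cast_nonneg d
        linarith)
      rw [norm_pos_iff]
      intro h0
      apply hxy
      funext i
      have := congrFun h0 i
      simp only [Pi.zero_apply, sub_eq_zero] at this
      exact_mod_cast this.symm

section RieszKernel

/-- The phase `n · k`. -/
def phase (n : Z d) (k : Fin d → ℝ) : ℝ := ∑ j, (n j : ℝ) * k j

/-- `(1/d) ∑ cos k_j`. -/
def gg (d : ℕ) (k : Fin d → ℝ) : ℝ := (1 / (d : ℝ)) * ∑ j, Real.cos (k j)

lemma box_compact : IsCompact (box d) := isCompact_univ_pi fun _ => isCompact_Icc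

lemma phase_cont (n : Z d) : Continuous (phase n) := by
  unfold phase; fun_prop

lemma gg_cont : Continuous (gg d) := by
  unfold gg; fun_prop

lemma integrable_box {g : (Fin d → ℝ) → ℝ} (hg : Continuous g) :
    Integrable g (volume.restrict (box d)) :=
  hg.continuousOn.integrableOn_compact box_compact

lemma factor_int (n : ℤ) : ∃ r : ℝ, 0 ≤ r ∧
    ∫ t in Set.Icc (0:ℝ) (2 * Real.pi), Complex.exp ((n : ℂ) * t * Complex.I) = (r : ℂ) := by
  have hpi := Real.pi_pos
  rw [integral_Icc_eq_integral_Ioc, ← intervalIntegral.integral_of_le (by linarith)]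
  by_cases hn : n = 0
  · refine ⟨2 * Real.pi, by linarith, ?_⟩
    subst hn
    simp
  · refine ⟨0, le_rfl, ?_⟩
    have hc : ((n : ℂ) * Complex.I) ≠ 0 := mul_ne_zero (by exact_mod_cast hn) Complex.I_ne_zero
    have e : ∀ t : ℝ, Complex.exp ((n : ℂ) * t * Complex.I) =
        Complex.exp (((n : ℂ) * Complex.I) * t) := fun t => by congr 1; ring
    simp only [e]
    rw [integral_exp_mul_complex hc]
    have h1 : ((n : ℂ) * Complex.I) * ((2 * Real.pi : ℝ) : ℂ) =
        n * (2 * Real.pi * Complex.I) := by push_cast; ring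
    rw [h1, Complex.exp_int_mul_two_pi_mul_I]
    simp

lemma base_int (n : Z d) : 0 ≤ ∫ k in box d, Real.cos (phase n k) := by
  choose r hr0 hr using factor_int
  have h1 : ∀ k : Fin d → ℝ, Real.cos (phase n k) =
      RCLike.re (∏ j, Complex.exp ((n j : ℂ) * k j * Complex.I)) := by
    intro k
    rw [← Complex.exp_sum, ← Finset.sum_mul]
    have : (∑ j, (n j : ℂ) * k j) = ((phase n k : ℝ) : ℂ) := by
      unfold phase; push_cast; rfl
    rw [this]
    exact (Complex.exp_ofReal_mul_I_re _).symm
  have hcont : Continuous fun k : Fin d → ℝ => ∏ j, Complex.exp ((n j : ℂ) * k j * Complex.I) := by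
    fun_prop
  have hres : (volume : Measure (Fin d → ℝ)).restrict (box d) =
      Measure.pi fun _ => volume.restrict (Set.Icc 0 (2 * Real.pi)) := by
    rw [volume_pi]; exact Measure.restrict_pi_pi _ _
  simp only [h1]
  rw [integral_re (𝕜 := ℂ)
    (hcont.continuousOn.integrableOn_compact box_compact : IntegrableOn _ _ _), hres,
    integral_fintype_prod_eq_prod (𝕜 := ℂ)
      (fun j (t : ℝ) => Complex.exp ((n j : ℂ) * t * Complex.I))]
  simp only [hr]
  rw [← Complex.ofReal_prod]
  simp only [RCLike.ofReal_re, Complex.coe_algebraMap, RCLike.re_to_complex, Complex.ofReal_re]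
  exact Finset.prod_nonneg fun j _ => hr0 _

lemma phase_add (n : Z d) (j : Fin d) (s : ℤ) (k : Fin d → ℝ) :
    phase (n + Pi.single j s) k = phase n k + s * k j := by
  unfold phase
  simp only [Pi.add_apply, Int.cast_add, add_mul, Finset.sum_add_distrib]
  congr 1
  rw [Finset.sum_eq_single j]
  · simp
  · intro b _ hb; simp [hb]
  · simp

lemma pow_int (m : ℕ) : ∀ n : Z d, 0 ≤ ∫ k in box d, Real.cos (phase n k) * gg d k ^ m := by
  induction m with
  | zero => intro n; simpa using base_int n
  | succ m ih =>
    intro n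
    have e : ∀ k, Real.cos (phase n k) * gg d k ^ (m + 1) =
        ∑ j, (1 / (d:ℝ)) * (1 / 2) *
          (Real.cos (phase (n + Pi.single j 1) k) * gg d k ^ m +
           Real.cos (phase (n + Pi.single j (-1)) k) * gg d k ^ m) := by
      intro k
      have h1 : ∀ j, Real.cos (phase (n + Pi.single j 1) k) * gg d k ^ m +
           Real.cos (phase (n + Pi.single j (-1)) k) * gg d k ^ m =
           2 * (Real.cos (phase n k) * gg d k ^ m) * Real.cos (k j) := by
        intro j
        rw [phase_add, phase_add]
        push_cast
        rw [one_mul, neg_one_mul, Real.cos_add, ← sub_eq_add_neg, Real.cos_sub]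
        ring
      simp only [h1]
      rw [← Finset.mul_sum, ← Finset.mul_sum, pow_succ]
      nth_rewrite 2 [gg]
      ring
    simp only [e]
    have hi : ∀ n : Z d, Integrable (fun k => Real.cos (phase n k) * gg d k ^ m)
        (volume.restrict (box d)) := fun n =>
      integrable_box ((Real.continuous_cos.comp (phase_cont n)).mul (gg_cont.pow m))
    have hi2 : ∀ j : Fin d, Integrable (fun k => 1 / (d:ℝ) * (1 / 2) *
        (Real.cos (phase (n + Pi.single j 1) k) * gg d k ^ m +
          Real.cos (phase (n + Pi.single j (-1)) k) * gg d k ^ m))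
        (volume.restrict (box d)) := fun j => ((hi _).add (hi _)).const_mul _
    rw [integral_finsetSum _ (fun j _ => hi2 j)]
    refine Finset.sum_nonneg fun j _ => ?_
    rw [integral_const_mul, integral_add (hi _) (hi _)]
    have := ih (n + Pi.single j 1)
    have := ih (n + Pi.single j (-1))
    positivity

lemma abs_gg_le (hd : 0 < d) (k : Fin d → ℝ) : |gg d k| ≤ 1 := by
  have hd' : (0:ℝ) < d := by exact_mod_cast hd
  unfold gg
  rw [abs_mul, abs_of_pos (by positivity), div_mul_eq_mul_div, one_mul, div_le_one hd']
  refine (Finset.abs_sum_le_sum_abs _ _).trans ?_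
  refine (Finset.sum_le_sum fun j _ => Real.abs_cos_le_one (k j)).trans ?_
  simp

lemma choose_nonneg {a : ℝ} (ha : 0 < a) (n : ℕ) : 0 ≤ Ring.choose (a + n - 1) n := by
  rw [Ring.choose, show a + n - 1 - n + 1 = a by ring]
  have h1 := Ring.factorial_nsmul_multichoose_eq_ascPochhammer a n
  rw [Polynomial.ascPochhammer_smeval_eq_eval] at h1
  have h2 := ascPochhammer_pos n a ha
  rw [← h1, nsmul_eq_mul] at h2
  exact (pos_of_mul_pos_right h2 (Nat.cast_nonneg _)).le

lemma binom_hasSum {a : ℝ} {x : ℝ} (hx : |x| < 1) :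
    HasSum (fun n : ℕ => Ring.choose (a + n - 1) n * x ^ n) ((1 - x) ^ (-a)) := by
  have h1 := Real.one_div_one_sub_rpow_hasFPowerSeriesOnBall_zero a
  have h2 := h1.hasSum (y := x) (by
    rw [← ENNReal.ofReal_one, Metric.eball_ofReal, mem_ball_zero_iff]; exact hx)
  simp only [FormalMultilinearSeries.ofScalars_apply_eq, smul_eq_mul, zero_add] at h2
  rw [Real.rpow_neg (by linarith [(abs_lt.1 hx).2]), ← one_div]
  exact h2

lemma int_r (hd : 0 < d) {a r : ℝ} (ha : 0 < a) (hr0 : 0 ≤ r) (hr1 : r < 1) (n : Z d) :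
    0 ≤ ∫ k in box d, Real.cos (phase n k) * (1 - r * gg d k) ^ (-a) := by
  have hg : ∀ k, |r * gg d k| ≤ r := fun k => by
    rw [abs_mul, abs_of_nonneg hr0]
    exact mul_le_of_le_one_right hr0 (abs_gg_le hd k)
  have hsr := (binom_hasSum (a := a) (x := r) (by rwa [abs_of_nonneg hr0])).summable
  set F : ℕ → (Fin d → ℝ) → ℝ := fun m k =>
    Ring.choose (a + m - 1) m * r ^ m * (Real.cos (phase n k) * gg d k ^ m) with hF
  have hFi : ∀ m, Integrable (F m) (volume.restrict (box d)) := fun m =>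
    integrable_box (continuous_const.mul
      ((Real.continuous_cos.comp (phase_cont n)).mul (gg_cont.pow m)))
  have hfin : IsFiniteMeasure (volume.restrict (box d)) :=
    ⟨by rw [Measure.restrict_apply_univ]; exact box_compact.measure_lt_top⟩
  have hsum : Summable fun m => ∫ k in box d, ‖F m k‖ := by
    refine Summable.of_nonneg_of_le (fun m => integral_nonneg fun k => norm_nonneg _) (fun m => ?_)
      (hsr.mul_right (∫ k in box d, (1:ℝ)))
    rw [← integral_const_mul]
    refine integral_mono (hFi m).norm (integrable_const _) fun k => ?_
    have h0 := mul_nonneg (choose_nonneg ha m) (pow_nonneg hr0 m)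
    simp only [hF, Real.norm_eq_abs]
    rw [abs_mul, abs_of_nonneg h0]
    refine mul_le_mul_of_nonneg_left ?_ h0
    rw [abs_mul, abs_pow]
    exact mul_le_one₀ (Real.abs_cos_le_one _) (by positivity)
      (pow_le_one₀ (abs_nonneg _) (abs_gg_le hd k))
  have hS := hasSum_integral_of_summable_integral_norm hFi hsum
  have e : ∀ k, ∑' m, F m k = Real.cos (phase n k) * (1 - r * gg d k) ^ (-a) := by
    intro k
    have h1 := (binom_hasSum (a := a) ((hg k).trans_lt hr1)).mul_left (Real.cos (phase n k))
    rw [← h1.tsum_eq]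
    refine tsum_congr fun m => ?_
    simp only [hF, mul_pow]
    ring
  simp only [e] at hS
  refine hS.nonneg fun m => ?_
  simp only [hF]
  rw [integral_const_mul]
  exact mul_nonneg (mul_nonneg (choose_nonneg ha m) (pow_nonneg hr0 m)) (pow_int m n)

lemma ae_gg_ne (hd : 0 < d) : ∀ᵐ k ∂(volume.restrict (box d)), gg d k ≠ 1 := by
  have hd' : (0:ℝ) < d := by exact_mod_cast hd
  refine ae_restrict_of_ae ?_
  set j0 : Fin d := ⟨0, hd⟩
  have h1 : ∀ᵐ k ∂(volume : Measure (Fin d → ℝ)), ∀ n : ℤ, k j0 ≠ n * (2 * Real.pi) := by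
    rw [ae_all_iff]
    intro n
    exact Measure.ae_eval_ne (μ := fun _ : Fin d => (volume : Measure ℝ)) j0 _
  filter_upwards [h1] with k hk hg
  have h2 : ∑ j, Real.cos (k j) = d := by
    unfold gg at hg
    field_simp at hg
    linarith
  have h3 : ∑ j, (1 - Real.cos (k j)) = 0 := by
    rw [Finset.sum_sub_distrib, h2]; simp
  have h4 := (Finset.sum_eq_zero_iff_of_nonneg
    (fun j _ => by linarith [Real.cos_le_one (k j)])).1 h3 j0 (Finset.mem_univ _)
  obtain ⟨n, hn⟩ := (Real.cos_eq_one_iff (k j0)).1 (by linarith)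
  exact hk n hn.symm

lemma muk_eq (hd : 0 < d) (k : Fin d → ℝ) : muk d k = 2 * d * (1 - gg d k) := by
  have hd' : (0:ℝ) < d := by exact_mod_cast hd
  unfold muk gg
  field_simp

lemma muk_nonneg (hd : 0 < d) (k : Fin d → ℝ) : 0 ≤ muk d k := by
  rw [muk_eq hd]
  have := (abs_le.1 (abs_gg_le hd k)).2
  exact mul_nonneg (by positivity) (by linarith)

lemma int_one (hd : 0 < d) {a : ℝ} (ha : 0 < a) (n : Z d)
    (hInt : Integrable (fun k => (1 - gg d k) ^ (-a)) (volume.restrict (box d))) :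
    0 ≤ ∫ k in box d, Real.cos (phase n k) * (1 - gg d k) ^ (-a) := by
  have hfin : IsFiniteMeasure (volume.restrict (box d)) :=
    ⟨by rw [Measure.restrict_apply_univ]; exact box_compact.measure_lt_top⟩
  have hg1 : ∀ k, gg d k ≤ 1 := fun k => (abs_le.1 (abs_gg_le hd k)).2
  have hlim : Tendsto (fun r : ℝ => ∫ k in box d, Real.cos (phase n k) * (1 - r * gg d k) ^ (-a))
      (𝓝[<] 1) (𝓝 (∫ k in box d, Real.cos (phase n k) * (1 - gg d k) ^ (-a))) := by
    refine tendsto_integral_filter_of_dominated_convergence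
      (fun k => (1 - gg d k) ^ (-a) + 1) ?_ ?_ (hInt.add (integrable_const _)) ?_
    · refine Eventually.of_forall fun r => Measurable.aestronglyMeasurable ?_
      exact (Real.continuous_cos.comp (phase_cont n)).measurable.mul
        (((continuous_const.sub (continuous_const.mul gg_cont)).measurable).pow_const _)
    · have hev : ∀ᶠ r : ℝ in 𝓝[<] 1, 0 < r ∧ r < 1 := by
        filter_upwards [nhdsWithin_le_nhds (lt_mem_nhds one_pos), self_mem_nhdsWithin]
          with r h1 h2 using ⟨h1, h2⟩
      filter_upwards [hev] with r hr
      filter_upwards [ae_gg_ne hd] with k hk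
      have hlt : gg d k < 1 := lt_of_le_of_ne (hg1 k) hk
      have hA : 0 ≤ (1 - gg d k) ^ (-a) := Real.rpow_nonneg (by linarith) _
      have hB : 0 ≤ (1 - r * gg d k) ^ (-a) := Real.rpow_nonneg (by nlinarith) _
      rw [Real.norm_eq_abs, abs_mul, abs_of_nonneg hB]
      refine (mul_le_of_le_one_left hB (Real.abs_cos_le_one _)).trans ?_
      rcases le_total 0 (gg d k) with h0 | h0
      · have := Real.rpow_le_rpow_of_nonpos (by linarith : 0 < 1 - gg d k)
          (by nlinarith : 1 - gg d k ≤ 1 - r * gg d k) (by linarith : -a ≤ 0)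
        linarith
      · have := Real.rpow_le_rpow_of_nonpos (one_pos)
          (by nlinarith : 1 ≤ 1 - r * gg d k) (by linarith : -a ≤ 0)
        rw [Real.one_rpow] at this
        linarith
    · filter_upwards [ae_gg_ne hd] with k hk
      have hne : 1 - gg d k ≠ 0 := sub_ne_zero.2 (Ne.symm hk)
      have h1 : Tendsto (fun r : ℝ => 1 - r * gg d k) (𝓝[<] 1) (𝓝 (1 - gg d k)) := by
        have : Continuous fun r : ℝ => 1 - r * gg d k := by fun_prop
        simpa using (this.tendsto 1).mono_left nhdsWithin_le_nhds
      exact (h1.rpow_const (Or.inl hne)).const_mul _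
  refine ge_of_tendsto hlim ?_
  filter_upwards [nhdsWithin_le_nhds (lt_mem_nhds one_pos), self_mem_nhdsWithin] with r h1 h2
  exact int_r hd ha (le_of_lt h1) h2 n

lemma Kfrac_nonneg (hd : 0 < d) (α : ℝ) : 0 ≤ Kfrac d α * (2 * Real.pi) ^ (-(d : ℝ)) := by
  have hpi := Real.pi_pos
  unfold Kfrac
  have : 0 ≤ ∫ k in box d, muk d k ^ (α / 2) :=
    integral_nonneg fun k => Real.rpow_nonneg (muk_nonneg hd k) _
  positivity

lemma Riesz_eq (α : ℝ) (x y : Z d) : Riesz d α x y = Kfrac d α * (2 * Real.pi) ^ (-(d : ℝ)) *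
    ∫ k in box d, Real.cos (phase (x - y) k) * muk d k ^ (-(α / 2)) := rfl

lemma phase_neg (n : Z d) (k : Fin d → ℝ) : phase (-n) k = - phase n k := by
  unfold phase
  simp

lemma phase_zero (k : Fin d → ℝ) : phase (0 : Z d) k = 0 := by
  unfold phase
  simp

lemma Riesz_diag (α : ℝ) (x : Z d) : Riesz d α x x = Riesz d α 0 0 := by
  rw [Riesz_eq, Riesz_eq]; simp

lemma Riesz_zero_nonneg (hd : 0 < d) (α : ℝ) : 0 ≤ Riesz d α 0 0 := by
  rw [Riesz_eq]
  refine mul_nonneg (Kfrac_nonneg hd α) (integral_nonneg fun k => ?_)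
  simp only [sub_self, phase_zero, Real.cos_zero, one_mul]
  exact Real.rpow_nonneg (muk_nonneg hd k) _

theorem Riesz_OK (hd : 0 < d) {α : ℝ} (hα : 0 < α) (h0 : Riesz d α 0 0 ≠ 0) :
    ROK (Riesz d α) (Riesz d α 0 0) := by
  have hK := Kfrac_nonneg hd α
  have hd' : (0:ℝ) < d := by exact_mod_cast hd
  have hInt : Integrable (fun k => muk d k ^ (-(α / 2))) (volume.restrict (box d)) := by
    by_contra hc
    apply h0
    rw [Riesz_eq]
    simp only [sub_self, phase_zero, Real.cos_zero, one_mul]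
    rw [integral_undef hc, mul_zero]
  have e : ∀ k, muk d k ^ (-(α / 2)) = (2 * d) ^ (-(α / 2)) * (1 - gg d k) ^ (-(α / 2)) := by
    intro k
    rw [muk_eq hd, Real.mul_rpow (by positivity)
      (by linarith [(abs_le.1 (abs_gg_le hd k)).2])]
  have hc0 : (0:ℝ) < (2 * d) ^ (-(α / 2)) := Real.rpow_pos_of_pos (by positivity) _
  have hInt' : Integrable (fun k => (1 - gg d k) ^ (-(α / 2))) (volume.restrict (box d)) := by
    have := hInt.const_mul ((2 * d) ^ (-(α / 2)))⁻¹
    refine this.congr (Eventually.of_forall fun k => ?_)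
    simp only [e]
    field_simp
  refine ⟨fun x y => ?_, fun x y => ?_, fun x y => ?_⟩
  · rw [Riesz_eq, Riesz_eq, ← neg_sub x y]
    simp only [phase_neg, Real.cos_neg]
  · rw [Riesz_eq]
    refine mul_nonneg hK ?_
    simp only [e, mul_left_comm (Real.cos _)]
    rw [integral_const_mul]
    exact mul_nonneg hc0.le (int_one hd (by linarith) _ hInt')
  · rw [Riesz_eq, Riesz_eq]
    refine mul_le_mul_of_nonneg_left ?_ hK
    simp only [sub_self, phase_zero, Real.cos_zero, one_mul]
    refine (le_abs_self _).trans ?_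
    rw [← Real.norm_eq_abs]
    refine norm_integral_le_of_norm_le hInt (Eventually.of_forall fun k => ?_)
    have := Real.rpow_nonneg (muk_nonneg hd k) (-(α / 2))
    rw [Real.norm_eq_abs, abs_mul, abs_of_nonneg this]
    exact mul_le_of_le_one_left this (Real.abs_cos_le_one _)

end RieszKernel


lemma F4_dlt {W : Z d → Z d → ℝ} {h : Z d → ℝ} {p α θ : ℝ} {f : ℝ → ℝ} (Hf : FOK f p θ)
    (hm : memH W h p (VOK.dlt 0)) (hd : 0 < d) (hf4 : F4 W h p α f) {t : ℝ} (ht : 0 < t) :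
    Riesz d α 0 0 ≠ 0 ∧ 0 < Fint f t := by
  have hpos : ∀ y : Z d, pos (VOK.dlt (0 : Z d)) y = if y = 0 then 1 else 0 := fun y => by
    unfold pos VOK.dlt; split_ifs <;> simp
  have hne : pos (VOK.dlt (0 : Z d)) ≠ 0 := fun h => by
    have := congrFun h 0
    rw [hpos] at this
    simp at this
  have hm4 := hf4 _ hm hne
  have hval : ∀ t : ℝ, (∑' x : Z d, conv d α (fun y => Fint f (t * pos (VOK.dlt (0 : Z d)) y)) x *
      f (t * pos (VOK.dlt (0 : Z d)) x) * pos (VOK.dlt (0 : Z d)) x)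
      = Riesz d α 0 0 * Fint f t * f t := fun t => by
    rw [tsum_eq_single (0 : Z d) (fun b hb => by rw [hpos b, if_neg hb, mul_zero]), hpos,
      if_pos rfl, mul_one, mul_one]
    congr 1
    unfold conv
    rw [tsum_eq_single (0 : Z d) (fun b hb => by
      beta_reduce
      rw [hpos b, if_neg hb, mul_zero, FOK.F_zero, mul_zero])]
    beta_reduce
    rw [hpos, if_pos rfl, mul_one]
  simp only [hval] at hm4
  have h1 := hm4 (Set.mem_Ioi.2 (half_pos ht)) (Set.mem_Ioi.2 ht) (half_lt_self ht)
  have h2 : 0 ≤ (t / 2) ^ (1 - p) * (Riesz d α 0 0 * Fint f (t / 2) * f (t / 2)) :=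
    mul_nonneg (Real.rpow_nonneg (half_pos ht).le _)
      (mul_nonneg (mul_nonneg (Riesz_zero_nonneg hd α) (Hf.F_nonneg (half_pos ht).le))
        (Hf.f_nonneg _))
  have h3 := lt_of_le_of_lt h2 h1
  beta_reduce at h3
  constructor
  · intro h0
    rw [h0] at h3; simp at h3
  · refine lt_of_le_of_ne (Hf.F_nonneg ht.le) fun h0 => ?_
    rw [← h0] at h3; simp at h3

lemma Mono4_of_F4 {W : Z d → Z d → ℝ} {h : Z d → ℝ} {p α : ℝ} {f : ℝ → ℝ}
    (hf4 : F4 W h p α f) : Mono4 (Vk W) (Riesz d α) h p f := by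
  intro u hu hpu
  refine (hf4 u ((Vk_memH W h p u).1 hu) hpu).congr fun t ht => ?_
  have ht' : 0 < t := ht
  have hmx : ∀ x, max (t * u x) 0 = t * pos u x := fun x => by
    unfold pos
    rw [mul_max_of_nonneg _ _ ht'.le, mul_zero]
  have e1 : t ^ (1 - p) = t ^ (-p) * t := by
    rw [show 1 - p = -p + 1 by ring, Real.rpow_add ht', Real.rpow_one]
  simp only [AA, bil, Phi, Psi, hmx]
  rw [e1, mul_assoc, ← tsum_mul_left]
  congr 1
  refine tsum_congr fun x => ?_
  change t * (cv (Riesz d α) (fun y => Fint f (t * pos u y)) x * f (t * pos u x) * pos u x) = _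
  ring

lemma energy_eq (W : Z d → Z d → ℝ) (h : Z d → ℝ) (p α : ℝ) (f : ℝ → ℝ) :
    energy W h p α f = JJ (Vk W) (Riesz d α) h p f := by
  funext u
  unfold energy JJ
  rw [Vk_HnormP]
  rfl

lemma Nehari_eq (W : Z d → Z d → ℝ) (h : Z d → ℝ) (p α : ℝ) (f : ℝ → ℝ) :
    Nehari W h p α f = MM (Vk W) (Riesz d α) h p f := by
  have hA : ∀ u : Z d → ℝ, (∑' x : Z d, conv d α (fun y => Fint f (pos u y)) x * f (pos u x) *
      pos u x) = AA (Riesz d α) f u := fun u => tsum_congr fun x => mul_assoc _ _ _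
  ext u
  simp only [Nehari, MM, Set.mem_setOf_eq, Vk_memH, Vk_HnormP, hA]

theorem existence_of_positive_ground_state
    {d : ℕ} (hd : 0 < d) {s p : ℝ} (hs : s ∈ Set.Ioo (0 : ℝ) 1) (hp : 2 ≤ p)
    {W : Z d → Z d → ℝ} (hW : KernelOK d s W)
    {α : ℝ} (hα : α ∈ Set.Ioo (0 : ℝ) (d : ℝ))
    {h : Z d → ℝ} {h₀ : ℝ} (hh₀ : 0 < h₀) (hh1 : ∀ x, h₀ ≤ h x)
    (hh2 : H2 h)
    {f : ℝ → ℝ} (hfc : Continuous f) (hfz : ∀ t ≤ (0 : ℝ), f t = 0)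
    (hf1 : F1 f p)
    {C₀ τ : ℝ} (hC₀ : 0 < C₀) (hτ : ((d : ℝ) + α) * p / (2 * d) < τ)
    (hf2 : ∀ t > (0 : ℝ), f t ≤ C₀ * (1 + t ^ (τ - 1)))
    {θ : ℝ} (hθ : p < θ) (hf3 : F3 f θ)
    (hf4 : F4 W h p α f)
 :
    ∃ u : Z d → ℝ, (∀ x, 0 < u x) ∧ memH W h p u ∧
      (∀ x : Z d,
        (Summable fun y : Z d =>
          W x y * (gradNorm W u x ^ (p - 2) + gradNorm W u y ^ (p - 2)) * (u x - u y)) ∧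
        (Summable fun y : Z d => Riesz d α x y * Fint f (u y)) ∧
        pLap W p u x + h x * u x ^ (p - 1) =
          conv d α (fun y => Fint f (u y)) x * f (u x)) ∧
      energy W h p α f u = sInf (energy W h p α f '' Nehari W h p α f) := by
  have Hh : HOK h h₀ p := ⟨hh₀, hh1, hh2, by linarith⟩
  have Hf : FOK f p θ := ⟨hfc, hfz, hf1, hf3, hp, hθ⟩
  have Hv : VOK (Vk W) := Vk_OK hs.1 hW
  have hdl : memH W h p (VOK.dlt 0) := (Vk_memH W h p _).1 (Hv.mem_dlt Hh hp 0)
  have key := fun (t : ℝ) (ht : 0 < t) => F4_dlt Hf hdl hd hf4 ht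
  have hR0 := (key 1 one_pos).1
  have H : Ctx (Vk W) (Riesz d α) (Riesz d α 0 0) h h₀ p f θ :=
    ⟨fun t ht => (key t ht).2, Hv, Riesz_OK hd hα.1 hR0, Hh, Hf, fun x => by
      rw [Riesz_diag]
      exact lt_of_le_of_ne (Riesz_zero_nonneg hd α) hR0.symm⟩
  have H4 := Mono4_of_F4 hf4
  obtain ⟨u, hu, hu0, hmin⟩ := H.exists_min H4
  have hEL := H.euler_lagrange H4 hu hu0 fun w hw => by
    rw [hmin]; exact csInf_le H.bddBelow ⟨w, hw, rfl⟩
  have hP : (fun y => Phi f (u y)) = fun y => Fint f (u y) := funext fun y => H.Phi_eq _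
  refine ⟨u, H.pos_of_solution hu hu0 hEL, (Vk_memH W h p u).1 hu.1, fun x => ⟨?_, ?_, ?_⟩, ?_⟩
  · have := (Hv.summable_pLap Hh hp hu.1 x).2
    simpa only [Vk_term] using this
  · have := H.r.summable_cv (H.sPhi hu.1) x
    simpa only [H.Phi_eq] using this
  · have := hEL x
    rw [Vk_pLap, hP] at this
    exact this
  · rw [energy_eq, Nehari_eq]
    exact hmin

end DiscreteChoquard
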